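/- arXiv:1405.5241 — 2 statements merged into one kernel-verified Lean document; each statement's English description precedes it below -/
import Mathlib

section
/- There exist β₀ > 0 and a constant c₂ > 0 such that for every β ≥ β₀, every integer h ≥ 2 and every z ∈ ℤ² with z ≠ 0 there exists L₀ = L₀(β,h,z) such that for all integers L ≥ L₀: π_{B_L}(η_z = h and η_0 = h) ≤ e^{−c₂·h²/(log h)²} · π_{B_L}(η_0 = h). -/
open Filter Topology Classical

noncomputable section

abbrev Site : Type := ℤ × ℤ

/-- Nearest-neighbor adjacency in `ℤ²`. -/
def adjP (x y : Site) : Prop := |x.1 - y.1| + |x.2 - y.2| = 1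

/-- The Discrete Gaussian Hamiltonian `H(η) = ∑_{x∼y} (η_x - η_y)²`, the sum running over
unordered nearest-neighbor pairs (each ordered pair is counted once, whence the factor 1/2). -/
def dgH (η : Site → ℤ) : ℝ :=
  (1 / 2) * ∑' p : Site × Site, if adjP p.1 p.2 then ((η p.1 - η p.2 : ℤ) : ℝ) ^ 2 else 0

/-- Unnormalized weight of the event `A` for the DG model on `Λ` with zero boundary conditions. -/
def dgW (β : ℝ) (Λ : Finset Site) (A : (Site → ℤ) → Prop) : ℝ :=
  ∑' η : Site → ℤ, if (∀ x ∉ Λ, η x = 0) ∧ A η then Real.exp (-β * dgH η) else 0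

/-- `π_Λ(A)`: probability of the event `A` under the DG measure on `Λ`. -/
def dgProb (β : ℝ) (Λ : Finset Site) (A : (Site → ℤ) → Prop) : ℝ :=
  dgW β Λ A / dgW β Λ (fun _ => True)

/-- `ϖ_Λ(A)`: DG measure conditioned on the floor event `η ≥ 0`. -/
def dgProbFloor (β : ℝ) (Λ : Finset Site) (A : (Site → ℤ) → Prop) : ℝ :=
  dgW β Λ (fun η => A η ∧ ∀ x, 0 ≤ η x) / dgW β Λ (fun η => ∀ x, 0 ≤ η x)

/-- The box `Λ_L = {1,…,L}²`. -/
def box (L : ℕ) : Finset Site := Finset.Icc (1 : ℤ) (L : ℤ) ×ˢ Finset.Icc (1 : ℤ) (L : ℤ)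

/-- The lattice ball `B_r = {x ∈ ℤ² : |x| ≤ r}`. -/
def ball (r : ℝ) : Finset Site :=
  ((Finset.Icc (-⌈r⌉) ⌈r⌉) ×ˢ (Finset.Icc (-⌈r⌉) ⌈r⌉)).filter
    fun x => ((x.1 : ℝ) ^ 2 + (x.2 : ℝ) ^ 2 ≤ r ^ 2)



abbrev Edge : Type := Site × Bool

def nb (e : Edge) : Site := if e.2 then (e.1.1, e.1.2 + 1) else (e.1.1 + 1, e.1.2)

def dd (η : Site → ℤ) (e : Edge) : ℤ := η (nb e) - η e.1

def HH (η : Site → ℤ) : ℝ := ∑' e, ((dd η e : ℤ) : ℝ) ^ 2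

def FS (η : Site → ℤ) : Prop := (Function.support (dd η)).Finite

def Om (Λ : Finset Site) (η : Site → ℤ) : Prop := ∀ x ∉ Λ, η x = 0

lemma nb_inj : Function.Injective (fun e : Edge => (nb e, e.2)) := by
  rintro ⟨⟨a, b⟩, c⟩ ⟨⟨a', b'⟩, c'⟩ h
  simp only [nb, Prod.mk.injEq] at h ⊢
  obtain ⟨h1, rfl⟩ := h
  cases c <;> simp at h1 <;> simp [h1]

lemma Om.fs {Λ : Finset Site} {η : Site → ℤ} (h : Om Λ η) : FS η := by
  have h1 : (Set.Finite {e : Edge | e.1 ∈ Λ}) := by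
    have : {e : Edge | e.1 ∈ Λ} ⊆ ((Λ ×ˢ (Finset.univ : Finset Bool) : Finset Edge) : Set Edge) := by
      intro e he; simpa using he
    exact (Finset.finite_toSet _).subset this
  have h2 : (Set.Finite {e : Edge | nb e ∈ Λ}) := by
    have := h1.preimage (nb_inj.injOn)
    exact this
  refine (h1.union h2).subset ?_
  intro e he
  by_contra hc
  simp only [Set.mem_union, Set.mem_setOf_eq, not_or] at hc
  apply he
  simp [dd, h _ hc.1, h _ hc.2]

lemma dd_add (η ξ : Site → ℤ) (e : Edge) : dd (η + ξ) e = dd η e + dd ξ e := by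
  simp [dd]; ring
lemma dd_sub (η ξ : Site → ℤ) (e : Edge) : dd (η - ξ) e = dd η e - dd ξ e := by
  simp [dd]; ring
lemma dd_neg (η : Site → ℤ) (e : Edge) : dd (-η) e = - dd η e := by
  simp [dd]; ring

lemma FS.summable {η : Site → ℤ} (h : FS η) : Summable (fun e => ((dd η e : ℤ) : ℝ) ^ 2) := by
  apply summable_of_finite_support
  refine h.subset ?_
  intro e he
  simp only [Function.mem_support] at he ⊢
  intro h0; apply he; simp [h0]

lemma FS.add {η ξ : Site → ℤ} (h : FS η) (h' : FS ξ) : FS (η + ξ) := by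
  refine (Set.Finite.union h h').subset ?_
  intro e he
  by_contra hc
  simp only [Set.mem_union, Function.mem_support, not_or, not_not] at hc he
  apply he; rw [dd_add, hc.1, hc.2]; rfl
lemma FS.neg {η : Site → ℤ} (h : FS η) : FS (-η) := by
  refine Set.Finite.subset h ?_
  intro e he
  simp only [Function.mem_support] at he ⊢
  intro h0; apply he; rw [dd_neg, h0]; rfl
lemma FS.sub {η ξ : Site → ℤ} (h : FS η) (h' : FS ξ) : FS (η - ξ) := by
  rw [sub_eq_add_neg]; exact h.add h'.neg

lemma HH_nonneg (η : Site → ℤ) : 0 ≤ HH η := tsum_nonneg fun _ => sq_nonneg _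

lemma HH_neg (η : Site → ℤ) : HH (-η) = HH η := by
  unfold HH; congr 1; ext e; rw [dd_neg]; push_cast; ring

lemma HH_parallelogram {η ξ : Site → ℤ} (h : FS η) (h' : FS ξ) :
    HH (η + ξ) + HH (η - ξ) = 2 * (HH η + HH ξ) := by
  unfold HH
  rw [← (h.add h').summable.tsum_add (h.sub h').summable, ← h.summable.tsum_add h'.summable,
    ← tsum_mul_left]
  congr 1; ext e; rw [dd_add, dd_sub]; push_cast; ring

lemma sum_le_HH {η : Site → ℤ} (h : FS η) (T : Finset Edge) :
    ∑ e ∈ T, ((dd η e : ℤ) : ℝ) ^ 2 ≤ HH η :=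
  h.summable.sum_le_tsum T fun _ _ => sq_nonneg _

def opair (q : Edge × Bool) : Site × Site := if q.2 then (q.1.1, nb q.1) else (nb q.1, q.1.1)

lemma opair_inj : Function.Injective opair := by
  rintro ⟨⟨⟨a, b⟩, c⟩, o⟩ ⟨⟨⟨a', b'⟩, c'⟩, o'⟩ h
  cases c <;> cases o <;> cases c' <;> cases o' <;>
    simp [opair, nb] at h ⊢ <;> omega

lemma opair_range {p : Site × Site} (h : adjP p.1 p.2) : p ∈ Set.range opair := by
  obtain ⟨⟨a, b⟩, ⟨a', b'⟩⟩ := p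
  simp only [adjP] at h
  have : (a' = a + 1 ∧ b' = b) ∨ (a = a' + 1 ∧ b' = b) ∨ (a' = a ∧ b' = b + 1) ∨
      (a' = a ∧ b = b' + 1) := by
    rcases abs_cases (a - a') with ⟨h1, _⟩ | ⟨h1, _⟩ <;>
    rcases abs_cases (b - b') with ⟨h2, _⟩ | ⟨h2, _⟩ <;> omega
  rcases this with ⟨rfl, rfl⟩ | ⟨rfl, rfl⟩ | ⟨rfl, rfl⟩ | ⟨rfl, rfl⟩
  · exact ⟨(((a, b'), false), true), by simp [opair, nb]⟩
  · exact ⟨(((a', b'), false), false), by simp [opair, nb]⟩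
  · exact ⟨(((a', b), true), true), by simp [opair, nb]⟩
  · exact ⟨(((a', b'), true), false), by simp [opair, nb]⟩

lemma opair_adj (q : Edge × Bool) : adjP (opair q).1 (opair q).2 := by
  obtain ⟨⟨⟨a, b⟩, c⟩, o⟩ := q
  cases c <;> cases o <;> simp [opair, nb, adjP]

lemma dgH_eq {η : Site → ℤ} (h : FS η) : dgH η = HH η := by
  unfold dgH
  have h1 : Function.support (fun p : Site × Site =>
      if adjP p.1 p.2 then ((η p.1 - η p.2 : ℤ) : ℝ) ^ 2 else 0) ⊆ Set.range opair := by
    intro p hp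
    apply opair_range
    by_contra hc
    simp [hc] at hp
  rw [← opair_inj.tsum_eq h1]
  have h2 : ∀ q : Edge × Bool, (if adjP (opair q).1 (opair q).2 then
      ((η (opair q).1 - η (opair q).2 : ℤ) : ℝ) ^ 2 else 0) = ((dd η q.1 : ℤ) : ℝ) ^ 2 := by
    intro q
    rw [if_pos (opair_adj q)]
    obtain ⟨e, o⟩ := q
    cases o <;> simp [opair, dd] ; ring
  simp only [h2]
  have hs : Summable (fun q : Edge × Bool => ((dd η q.1 : ℤ) : ℝ) ^ 2) := by
    apply summable_of_finite_support
    have : (Function.support fun q : Edge × Bool => ((dd η q.1 : ℤ) : ℝ) ^ 2) ⊆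
        (Function.support (dd η)) ×ˢ (Set.univ : Set Bool) := by
      intro q hq
      simp at hq ⊢; exact hq
    exact (Set.Finite.prod h Set.finite_univ).subset this
  rw [hs.tsum_prod' (fun e => Summable.of_finite)]
  simp only [tsum_bool]
  unfold HH
  rw [← tsum_mul_left]
  congr 1; ext e; ring

def wR (β : ℝ) (Λ : Finset Site) (η : Site → ℤ) : ℝ := if Om Λ η then Real.exp (-β * HH η) else 0

def Wt (β : ℝ) (Λ : Finset Site) (η : Site → ℤ) : ENNReal := ENNReal.ofReal (wR β Λ η)

def WE (β : ℝ) (Λ : Finset Site) (A : (Site → ℤ) → Prop) : ENNReal :=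
  ∑' η, if A η then Wt β Λ η else 0

lemma wR_nonneg (β : ℝ) (Λ : Finset Site) (η : Site → ℤ) : 0 ≤ wR β Λ η := by
  unfold wR; split_ifs <;> positivity

lemma dgW_eq (β : ℝ) (Λ : Finset Site) (A : (Site → ℤ) → Prop) :
    dgW β Λ A = (WE β Λ A).toReal := by
  unfold WE
  rw [ENNReal.tsum_toReal_eq]
  · unfold dgW
    congr 1; ext η
    by_cases h : Om Λ η
    · by_cases hA : A η
      · have : (∀ x ∉ Λ, η x = 0) ∧ A η := ⟨h, hA⟩
        rw [if_pos this, if_pos hA, Wt, ENNReal.toReal_ofReal (wR_nonneg _ _ _), wR, if_pos h,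
          dgH_eq h.fs]
      · have : ¬ ((∀ x ∉ Λ, η x = 0) ∧ A η) := fun hh => hA hh.2
        rw [if_neg this, if_neg hA]; rfl
    · have : ¬ ((∀ x ∉ Λ, η x = 0) ∧ A η) := fun hh => h hh.1
      rw [if_neg this, Wt, wR, if_neg h]; simp
  · intro η; split_ifs <;> simp [Wt]

lemma WE_mono {β : ℝ} {Λ : Finset Site} {A B : (Site → ℤ) → Prop} (h : ∀ η, A η → B η) :
    WE β Λ A ≤ WE β Λ B := by
  apply ENNReal.tsum_le_tsum
  intro η
  by_cases hA : A η
  · rw [if_pos hA, if_pos (h η hA)]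
  · rw [if_neg hA]; exact zero_le

/-- four functions theorem for infinite sums -/
lemma ff_tsum {α : Type*} [DistribLattice α] (f₁ f₂ f₃ f₄ : α → ℝ)
    (h₁ : 0 ≤ f₁) (h₂ : 0 ≤ f₂) (h₃ : 0 ≤ f₃) (h₄ : 0 ≤ f₄)
    (h : ∀ a b, f₁ a * f₂ b ≤ f₃ (a ⊓ b) * f₄ (a ⊔ b)) :
    (∑' a, ENNReal.ofReal (f₁ a)) * (∑' a, ENNReal.ofReal (f₂ a)) ≤
      (∑' a, ENNReal.ofReal (f₃ a)) * (∑' a, ENNReal.ofReal (f₄ a)) := by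
  rw [ENNReal.tsum_eq_iSup_sum, ENNReal.iSup_mul]
  refine iSup_le fun s => ?_
  rw [ENNReal.tsum_eq_iSup_sum, ENNReal.mul_iSup]
  refine iSup_le fun t => ?_
  have := four_functions_theorem f₁ f₂ f₃ f₄ h₁ h₂ h₃ h₄ h s t
  rw [← ENNReal.ofReal_sum_of_nonneg (fun a _ => h₁ a), ← ENNReal.ofReal_sum_of_nonneg (fun a _ => h₂ a),
    ← ENNReal.ofReal_mul (Finset.sum_nonneg fun a _ => h₁ a)]
  refine (ENNReal.ofReal_le_ofReal this).trans ?_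
  rw [ENNReal.ofReal_mul (Finset.sum_nonneg fun a _ => h₃ a),
    ENNReal.ofReal_sum_of_nonneg (fun a _ => h₃ a), ENNReal.ofReal_sum_of_nonneg (fun a _ => h₄ a)]
  exact mul_le_mul' (ENNReal.sum_le_tsum _) (ENNReal.sum_le_tsum _)

lemma FS.inf {η ξ : Site → ℤ} (h : FS η) (h' : FS ξ) : FS (η ⊓ ξ) := by
  refine (Set.Finite.union h h').subset ?_
  intro e he
  by_contra hc
  simp only [Set.mem_union, Function.mem_support, not_or, not_not, dd, Pi.inf_apply] at hc he
  rw [sub_eq_zero, sub_eq_zero] at hc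
  apply he; rw [hc.1, hc.2]; simp
lemma FS.sup {η ξ : Site → ℤ} (h : FS η) (h' : FS ξ) : FS (η ⊔ ξ) := by
  refine (Set.Finite.union h h').subset ?_
  intro e he
  by_contra hc
  simp only [Set.mem_union, Function.mem_support, not_or, not_not, dd, Pi.sup_apply] at hc he
  rw [sub_eq_zero, sub_eq_zero] at hc
  apply he; rw [hc.1, hc.2]; simp

lemma submod (a b c d : ℤ) :
    (min a c - min b d) ^ 2 + (max a c - max b d) ^ 2 ≤ (a - b) ^ 2 + (c - d) ^ 2 := by
  rcases le_total a c with h | h <;> rcases le_total b d with h' | h' <;>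
    simp only [h, h', min_eq_left, min_eq_right, max_eq_left, max_eq_right] <;>
    nlinarith [mul_nonneg (sub_nonneg.2 h) (sub_nonneg.2 h')]

lemma HH_submod {η ξ : Site → ℤ} (h : FS η) (h' : FS ξ) :
    HH (η ⊓ ξ) + HH (η ⊔ ξ) ≤ HH η + HH ξ := by
  unfold HH
  rw [← (h.inf h').summable.tsum_add (h.sup h').summable, ← h.summable.tsum_add h'.summable]
  refine Summable.tsum_le_tsum ?_ ((h.inf h').summable.add (h.sup h').summable)
    (h.summable.add h'.summable)
  intro e
  have := submod (η (nb e)) (η e.1) (ξ (nb e)) (ξ e.1)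
  simp only [dd, Pi.inf_apply, Pi.sup_apply]
  exact_mod_cast this

lemma dd_sub_one (η : Site → ℤ) (e : Edge) : dd (η - 1) e = dd η e := by
  simp [dd]
lemma HH_sub_one (η : Site → ℤ) : HH (η - 1) = HH η := by
  unfold HH; simp only [dd_sub_one]
lemma FS_sub_one {η : Site → ℤ} (h : FS (η - 1)) : FS η := by
  unfold FS at *; convert h using 2; ext e; rw [dd_sub_one]

lemma W_lc {β : ℝ} (hβ : 0 ≤ β) (Λ : Finset Site) (x z : Site) (a b δ : ℤ) (hδ : δ ≤ 1) :
    WE β Λ (fun η => η x = a + δ ∧ η z = b + 1) * WE β Λ (fun η => η x = a ∧ η z = b - 1) ≤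
    WE β Λ (fun η => η x = a + δ ∧ η z = b) * WE β Λ (fun η => η x = a ∧ η z = b) := by
  have key : ∀ A : (Site → ℤ) → Prop, WE β Λ A =
      ∑' η, ENNReal.ofReal (if A η then wR β Λ η else 0) := by
    intro A; unfold WE; congr 1; ext η; split_ifs <;> simp [Wt]
  have key2 : ∀ A : (Site → ℤ) → Prop, WE β Λ A =
      ∑' η, ENNReal.ofReal (if A (η - 1) then wR β Λ (η - 1) else 0) := by
    intro A; rw [key, ← (Equiv.subRight (1 : Site → ℤ)).tsum_eq]; rfl
  rw [key, key2 (fun η => η x = a ∧ η z = b - 1), key (fun η => η x = a + δ ∧ η z = b),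
    key2 (fun η => η x = a ∧ η z = b)]
  have nn : ∀ (P : Prop) (η), 0 ≤ (if P then wR β Λ η else 0) := by
    intro P η; split_ifs; exacts [wR_nonneg _ _ _, le_rfl]
  refine ff_tsum _ _ _ _ (fun η => nn _ _) (fun η => nn _ _) (fun η => nn _ _) (fun η => nn _ _) ?_
  intro p q
  by_cases hp : p x = a + δ ∧ p z = b + 1
  swap
  · rw [if_neg hp, zero_mul]; exact mul_nonneg (nn _ _) (nn _ _)
  by_cases hq : (q - 1) x = a ∧ (q - 1) z = b - 1
  swap
  · rw [if_neg hq, mul_zero]; exact mul_nonneg (nn _ _) (nn _ _)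
  by_cases hp' : Om Λ p
  swap
  · rw [wR, if_neg hp', ite_self, zero_mul]; exact mul_nonneg (nn _ _) (nn _ _)
  by_cases hq' : Om Λ (q - 1)
  swap
  · rw [wR, wR, if_neg hq', ite_self, mul_zero]; exact mul_nonneg (nn _ _) (nn _ _)
  simp only [Pi.sub_apply, Pi.one_apply] at hq
  have c3 : (p ⊓ q) x = a + δ ∧ (p ⊓ q) z = b := by
    simp only [Pi.inf_apply]; constructor <;> omega
  have c4 : (p ⊔ q - 1) x = a ∧ (p ⊔ q - 1) z = b := by
    simp only [Pi.sup_apply, Pi.sub_apply, Pi.one_apply]; constructor <;> omega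
  have o3 : Om Λ (p ⊓ q) := by
    intro y hy
    have h1 := hp' y hy
    have h2 := hq' y hy
    simp only [Pi.inf_apply, Pi.sub_apply, Pi.one_apply] at *; omega
  have o4 : Om Λ (p ⊔ q - 1) := by
    intro y hy
    have h1 := hp' y hy
    have h2 := hq' y hy
    simp only [Pi.sup_apply, Pi.sub_apply, Pi.one_apply] at *; omega
  have hq1 : (q - 1) x = a ∧ (q - 1) z = b - 1 := by simpa using hq
  rw [if_pos hp, if_pos hq1, if_pos c3, if_pos c4, wR, wR, wR, wR, if_pos hp', if_pos hq', if_pos o3,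
    if_pos o4, ← Real.exp_add, ← Real.exp_add, Real.exp_le_exp, HH_sub_one, HH_sub_one]
  have := HH_submod hp'.fs (FS_sub_one hq'.fs)
  nlinarith

/-! rotation -/
def par (s : Site → ℤ) : Site → ZMod 2 := fun x => (s x : ZMod 2)

lemma rot (K : (Site → ℤ) → (Site → ℤ) → ENNReal) :
    ∑' p : (Site → ℤ) × (Site → ℤ), K (p.1 + p.2) (p.1 - p.2) =
      ∑' s, ∑' d, if par s = par d then K s d else 0 := by
  rw [← ENNReal.tsum_prod (f := fun s d => if par s = par d then K s d else 0)]
  have inj : Function.Injective (fun p : (Site → ℤ) × (Site → ℤ) => (p.1 + p.2, p.1 - p.2)) := by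
    rintro ⟨p, q⟩ ⟨p', q'⟩ h
    simp only [Prod.mk.injEq] at h ⊢
    constructor <;> ext x
    · have h1 := congrFun h.1 x
      have h2 := congrFun h.2 x
      simp only [Pi.add_apply, Pi.sub_apply] at h1 h2; omega
    · have h1 := congrFun h.1 x
      have h2 := congrFun h.2 x
      simp only [Pi.add_apply, Pi.sub_apply] at h1 h2; omega
  have hpar : ∀ p q : Site → ℤ, par (p + q) = par (p - q) := by
    intro p q; ext x
    simp only [par, Pi.add_apply, Pi.sub_apply]
    push_cast
    rw [sub_eq_add_neg, ZMod.neg_eq_self_mod_two]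
  symm
  rw [← inj.tsum_eq (f := fun q => if par q.1 = par q.2 then K q.1 q.2 else 0)]
  · congr 1; ext p; simp only; rw [if_pos (hpar _ _)]
  · rintro ⟨s, d⟩ hsd
    simp only [Function.mem_support] at hsd
    have hp : par s = par d := by by_contra hc; rw [if_neg hc] at hsd; exact hsd rfl
    have : ∀ x, ∃ k, s x - d x = 2 * k := by
      intro x
      have := congrFun hp x
      simp only [par] at this
      rw [ZMod.intCast_eq_intCast_iff_dvd_sub] at this
      obtain ⟨k, hk⟩ := this
      exact ⟨-k, by push_cast at hk; linarith⟩
    choose k hk using this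
    refine ⟨(d + k, k), ?_⟩
    simp only [Prod.mk.injEq]
    constructor <;> ext x
    · have := hk x; simp only [Pi.add_apply]; omega
    · simp

lemma two_mul_le' (a b : ENNReal) : 2 * (a * b) ≤ a * a + b * b := by
  rcases le_total a b with h | h
  · obtain ⟨c, rfl⟩ := exists_add_of_le h
    calc _ ≤ 2 * (a * (a + c)) + c * c := le_self_add
      _ = _ := by ring
  · obtain ⟨c, rfl⟩ := exists_add_of_le h
    calc _ ≤ 2 * ((b + c) * b) + c * c := le_self_add
      _ = _ := by ring

lemma key_eq {α K : Type*} [DecidableEq K] (κ κ' : α → K) (f g : α → ENNReal) :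
    ∑' s, ∑' d, (if κ s = κ' d then f s * g d else 0) =
      ∑' c, (∑' s, if κ s = c then f s else 0) * (∑' d, if κ' d = c then g d else 0) := by
  have : ∀ c, (∑' s, if κ s = c then f s else 0) * (∑' d, if κ' d = c then g d else 0) =
      ∑' s, ∑' d, if κ s = c ∧ κ' d = c then f s * g d else 0 := by
    intro c
    rw [← ENNReal.tsum_mul_right]
    congr 1; ext s
    rw [← ENNReal.tsum_mul_left]
    congr 1; ext d
    by_cases h1 : κ s = c <;> by_cases h2 : κ' d = c <;> simp [h1, h2]
  simp only [this]
  conv_rhs => rw [ENNReal.tsum_comm]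
  refine tsum_congr fun s => ?_
  conv_rhs => rw [ENNReal.tsum_comm]
  refine tsum_congr fun d => ?_
  rw [tsum_eq_single (κ s)]
  · by_cases h : κ s = κ' d
    · simp [h]
    · have : ¬ κ' d = κ s := fun h' => h h'.symm
      simp [h, this]
  · intro c hc
    rw [if_neg]; rintro ⟨h, -⟩; exact hc h.symm

lemma key_le {α K : Type*} [DecidableEq K] (κ κ' : α → K) (f g : α → ENNReal) :
    2 * ∑' s, ∑' d, (if κ s = κ' d then f s * g d else 0) ≤
      (∑' s, ∑' d, if κ s = κ d then f s * f d else 0) +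
      (∑' s, ∑' d, if κ' s = κ' d then g s * g d else 0) := by
  rw [key_eq, key_eq, key_eq, ← ENNReal.tsum_mul_left, ← ENNReal.tsum_add]
  exact ENNReal.tsum_le_tsum fun c => two_mul_le' _ _

lemma tsum_mul_tsum' {α : Type*} (F G : α → ENNReal) :
    (∑' a, F a) * (∑' a, G a) = ∑' p : α × α, F p.1 * G p.2 := by
  rw [ENNReal.tsum_prod (f := fun a b => F a * G b), ← ENNReal.tsum_mul_right]
  congr 1; ext a; rw [ENNReal.tsum_mul_left]

lemma Wt_mul (β : ℝ) (Λ : Finset Site) (p q : Site → ℤ) :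
    Wt β Λ p * Wt β Λ q = Wt (β / 2) Λ (p + q) * Wt (β / 2) Λ (p - q) := by
  unfold Wt
  rw [← ENNReal.ofReal_mul (wR_nonneg _ _ _), ← ENNReal.ofReal_mul (wR_nonneg _ _ _)]
  congr 1
  by_cases h : Om Λ p ∧ Om Λ q
  · have h1 : Om Λ (p + q) := fun x hx => by simp [h.1 x hx, h.2 x hx]
    have h2 : Om Λ (p - q) := fun x hx => by simp [h.1 x hx, h.2 x hx]
    rw [wR, wR, wR, wR, if_pos h.1, if_pos h.2, if_pos h1, if_pos h2, ← Real.exp_add, ← Real.exp_add]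
    congr 1
    have := HH_parallelogram h.1.fs h.2.fs
    linear_combination (β / 2) * this
  · have h' : ¬ (Om Λ (p + q) ∧ Om Λ (p - q)) := by
      rintro ⟨h1, h2⟩
      apply h
      constructor <;> intro x hx <;> have e1 := h1 x hx <;> have e2 := h2 x hx <;>
        simp only [Pi.add_apply, Pi.sub_apply] at e1 e2 <;> omega
    have z1 : wR β Λ p * wR β Λ q = 0 := by
      by_cases hp : Om Λ p
      · have hq : ¬ Om Λ q := fun hq => h ⟨hp, hq⟩
        rw [wR, wR, if_neg hq, mul_zero]
      · rw [wR, if_neg hp, zero_mul]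
    have z2 : wR (β / 2) Λ (p + q) * wR (β / 2) Λ (p - q) = 0 := by
      by_cases hp : Om Λ (p + q)
      · have hq : ¬ Om Λ (p - q) := fun hq => h' ⟨hp, hq⟩
        rw [wR, wR, if_neg hq, mul_zero]
      · rw [wR, if_neg hp, zero_mul]
    rw [z1, z2]

lemma W_pin (β : ℝ) (Λ : Finset Site) (x y : Site) (h : ℤ) :
    WE β Λ (fun η => η x = h ∧ η y = 0) * WE β Λ (fun η => η x = 0) ≤
      WE β Λ (fun η => η x = h) * WE β Λ (fun η => η x = 0 ∧ η y = 0) := by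
  set f : (Site → ℤ) → ENNReal := fun s => if s x = h then Wt (β / 2) Λ s else 0 with hf
  have e1 : WE β Λ (fun η => η x = h ∧ η y = 0) * WE β Λ (fun η => η x = 0) =
      ∑' s, ∑' d, if (par s, s y) = (par d, - d y) then f s * f d else 0 := by
    unfold WE
    rw [tsum_mul_tsum']
    have := rot (fun s d => if s y = - d y then f s * f d else 0)
    rw [show (∑' s, ∑' d, if (par s, s y) = (par d, - d y) then f s * f d else 0) =
      ∑' s, ∑' d, if par s = par d then (if s y = - d y then f s * f d else 0) else 0 from ?_, ← this]
    · congr 1; ext ⟨p, q⟩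
      simp only [hf, Pi.add_apply, Pi.sub_apply]
      by_cases hc : (p x = h ∧ p y = 0) ∧ q x = 0
      · rw [if_pos hc.1, if_pos hc.2, if_pos (by omega), if_pos (by omega), if_pos (by omega), Wt_mul]
      · by_cases h1 : p y + q y = -(p y - q y)
        · rw [if_pos h1]
          by_cases h2 : p x + q x = h
          · by_cases h3 : p x - q x = h
            · exfalso; apply hc; omega
            · rw [if_neg h3, mul_zero]
              by_cases h4 : q x = 0
              · rw [if_neg (fun h5 => hc ⟨h5, h4⟩), zero_mul]
              · rw [if_neg h4, mul_zero]
          · rw [if_neg h2, zero_mul]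
            by_cases h4 : q x = 0
            · rw [if_neg (fun h5 => hc ⟨h5, h4⟩), zero_mul]
            · rw [if_neg h4, mul_zero]
        · rw [if_neg h1]
          by_cases h4 : q x = 0
          · rw [if_neg (fun h5 => hc ⟨h5, h4⟩), zero_mul]
          · rw [if_neg h4, mul_zero]
    · congr 1; ext s; congr 1; ext d
      simp only [Prod.mk.injEq, ite_and]
  have e2 : WE β Λ (fun η => η x = h) * WE β Λ (fun η => η x = 0 ∧ η y = 0) =
      ∑' s, ∑' d, if (par s, s y) = (par d, d y) then f s * f d else 0 := by
    unfold WE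
    rw [tsum_mul_tsum']
    have := rot (fun s d => if s y = d y then f s * f d else 0)
    rw [show (∑' s, ∑' d, if (par s, s y) = (par d, d y) then f s * f d else 0) =
      ∑' s, ∑' d, if par s = par d then (if s y = d y then f s * f d else 0) else 0 from ?_, ← this]
    · congr 1; ext ⟨p, q⟩
      simp only [hf, Pi.add_apply, Pi.sub_apply]
      by_cases hc : p x = h ∧ (q x = 0 ∧ q y = 0)
      · rw [if_pos hc.1, if_pos hc.2, if_pos (by omega), if_pos (by omega), if_pos (by omega), Wt_mul]
      · have hl : (if p x = h then Wt β Λ p else 0) * (if q x = 0 ∧ q y = 0 then Wt β Λ q else 0) = 0 := by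
          by_cases h4 : p x = h
          · rw [if_neg (fun h5 => hc ⟨h4, h5⟩), mul_zero]
          · rw [if_neg h4, zero_mul]
        rw [hl]
        by_cases h1 : p y + q y = (p y - q y)
        · rw [if_pos h1]
          by_cases h2 : p x + q x = h
          · by_cases h3 : p x - q x = h
            · exfalso; apply hc; omega
            · rw [if_neg h3, mul_zero]
          · rw [if_neg h2, zero_mul]
        · rw [if_neg h1]
    · congr 1; ext s; congr 1; ext d
      simp only [Prod.mk.injEq, ite_and]
  rw [e1, e2]
  have := key_le (fun s : Site → ℤ => (par s, s y)) (fun s : Site → ℤ => (par s, - s y)) f f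
  have h3 : (∑' s, ∑' d, if (par s, -s y) = (par d, -d y) then f s * f d else 0) =
      ∑' s, ∑' d, if (par s, s y) = (par d, d y) then f s * f d else 0 := by
    simp only [Prod.mk.injEq, neg_inj]
  rw [h3, ← two_mul] at this
  exact (ENNReal.mul_le_mul_iff_right (by norm_num) (by norm_num)).1 this

def ZL (β : ℝ) (Λ : Finset Site) (ℓ : (Site → ℤ) →+ ℝ) : ENNReal :=
  ∑' η, ENNReal.ofReal (Real.exp (ℓ η)) * Wt β Λ η

lemma ZL_ineq (β : ℝ) (Λ : Finset Site) (ℓ : (Site → ℤ) →+ ℝ) (t : ENNReal) :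
    2 * (t * ZL β Λ ℓ ^ 2) ≤ t ^ 2 * (ZL β Λ (ℓ + ℓ) * ZL β Λ 0) + ZL β Λ 0 ^ 2 := by
  set g : (Site → ℤ) → ENNReal := fun s => Wt (β / 2) Λ s with hg
  set E : (Site → ℤ) → ENNReal := fun s => ENNReal.ofReal (Real.exp (ℓ s)) with hE
  have Eadd : ∀ p q, E (p + q) = E p * E q := by
    intro p q; simp only [hE]
    rw [map_add, Real.exp_add, ENNReal.ofReal_mul (Real.exp_nonneg _)]
  have E2 : ∀ p q, E (p + q) * E (p - q) = ENNReal.ofReal (Real.exp ((ℓ + ℓ) p)) := by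
    intro p q
    rw [← Eadd]; simp only [hE]; congr 2
    rw [AddMonoidHom.add_apply, ← map_add]; congr 1; abel
  set f : (Site → ℤ) → ENNReal := fun s => t * (E s * g s) with hf
  have e1 : (∑' s, ∑' d, if par s = par d then f s * g d else 0) = t * ZL β Λ ℓ ^ 2 := by
    rw [← rot (fun s d => f s * g d), sq, ZL, tsum_mul_tsum', ← ENNReal.tsum_mul_left]
    congr 1; ext ⟨p, q⟩
    simp only [hf, Eadd]
    calc _ = t * (E p * E q) * (g (p + q) * g (p - q)) := by ring
      _ = t * (E p * E q) * (Wt β Λ p * Wt β Λ q) := by rw [Wt_mul β Λ p q]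
      _ = _ := by ring
  have e2 : (∑' s, ∑' d, if par s = par d then f s * f d else 0) =
      t ^ 2 * (ZL β Λ (ℓ + ℓ) * ZL β Λ 0) := by
    rw [← rot (fun s d => f s * f d), ZL, ZL, tsum_mul_tsum', ← ENNReal.tsum_mul_left]
    congr 1; ext ⟨p, q⟩
    simp only [hf]
    calc _ = t ^ 2 * (E (p + q) * E (p - q)) * (g (p + q) * g (p - q)) := by ring
      _ = t ^ 2 * (E (p + q) * E (p - q)) * (Wt β Λ p * Wt β Λ q) := by rw [Wt_mul β Λ p q]
      _ = _ := by rw [E2]; simp; ring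
  have e3 : (∑' s, ∑' d, if par s = par d then g s * g d else 0) = ZL β Λ 0 ^ 2 := by
    rw [← rot (fun s d => g s * g d), sq, ZL, tsum_mul_tsum']
    congr 1; ext ⟨p, q⟩
    simp [hg, ← Wt_mul]
  rw [← e1, ← e2, ← e3]
  exact key_le par par f g

def pl (p : Site) : Finset Edge :=
  {(p, false), ((p.1, p.2 + 1), false), (p, true), ((p.1 + 1, p.2), true)}

def eadj (e f : Edge) : Prop := ∃ p, e ∈ pl p ∧ f ∈ pl p

lemma eadj_symm {e f : Edge} (h : eadj e f) : eadj f e := by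
  obtain ⟨p, h1, h2⟩ := h; exact ⟨p, h2, h1⟩

def opp (e : Edge) : Site := if e.2 then (e.1.1 - 1, e.1.2) else (e.1.1, e.1.2 - 1)

def nbrs (e : Edge) : Finset Edge := pl e.1 ∪ pl (opp e)

lemma nbrs_card (e : Edge) : (nbrs e).card ≤ 8 := by
  have h : ∀ p, (pl p).card ≤ 4 := fun p => Finset.card_le_four
  exact (Finset.card_union_le _ _).trans (by linarith [h e.1, h (opp e)])

lemma mem_nbrs {e f : Edge} (h : eadj e f) : f ∈ nbrs e := by
  obtain ⟨⟨a, b⟩, h1, h2⟩ := h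
  have h3 : (a, b) = e.1 ∨ (a, b) = opp e := by
    simp only [pl, Finset.mem_insert, Finset.mem_singleton] at h1
    rcases h1 with rfl | rfl | rfl | rfl <;> simp [opp]
  rcases h3 with h3 | h3
  · rw [nbrs, ← h3]; exact Finset.mem_union_left _ h2
  · rw [nbrs, ← h3]; exact Finset.mem_union_right _ h2

/-- step relation inside the support -/
def RS (S : Set Edge) (e f : Edge) : Prop := eadj e f ∧ e ∈ S ∧ f ∈ S

def conn (g : Edge → ℤ) : Prop := ∀ e ∈ Function.support g, ∀ f ∈ Function.support g,
  Relation.ReflTransGen (RS (Function.support g)) e f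

def closed (g : Edge → ℤ) : Prop := ∀ a b : ℤ,
  g ((a, b), false) + g ((a + 1, b), true) = g ((a, b), true) + g ((a, b + 1), false)

lemma closed_dd (η : Site → ℤ) : closed (dd η) := by
  intro a b; simp [dd, nb]

lemma tsum_tele (u : ℕ → ℤ) (hu : (Function.support u).Finite) :
    ∑' j, u j = u 0 + ∑' j, u (j + 1) :=
  (summable_of_finite_support hu).tsum_eq_zero_add

lemma fin_comp {g : Edge → ℤ} (hg : (Function.support g).Finite) {i : ℕ → Edge}
    (hi : Function.Injective i) : (Function.support (fun j => g (i j))).Finite :=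
  hg.preimage hi.injOn

lemma potential {g : Edge → ℤ} (hc : closed g) (hg : (Function.support g).Finite) :
    ∃ χ : Site → ℤ, dd χ = g ∧ ∀ b, (∀ a, g ((a, b), false) = 0) → ∀ a, χ (a, b) = 0 := by
  have inj : ∀ a b : ℤ, ∀ c, Function.Injective (fun j : ℕ => (((a + j, b), c) : Edge)) := by
    intro a b c i j h; simpa using h
  have inj' : ∀ a b : ℤ, ∀ c, Function.Injective (fun j : ℕ => (((a + (j + 1 : ℕ), b), c) : Edge)) := by
    intro a b c i j h; simpa using h
  refine ⟨fun x => - ∑' j : ℕ, g ((x.1 + j, x.2), false), ?_, ?_⟩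
  · ext ⟨⟨a, b⟩, c⟩
    cases c
    · simp only [dd, nb]
      have := tsum_tele (fun j : ℕ => g ((a + j, b), false)) (fin_comp hg (inj a b false))
      simp only [Bool.false_eq_true, if_false, this]
      simp only [Nat.cast_zero, add_zero, Nat.cast_add, Nat.cast_one, add_assoc, add_comm (1 : ℤ)]
      ring
    · simp only [dd, nb, if_true]
      have h1 := tsum_tele (fun j : ℕ => g ((a + j, b), true)) (fin_comp hg (inj a b true))
      have h2 : ∑' j : ℕ, g ((a + j, b), false) + ∑' j : ℕ, g ((a + (j + 1 : ℕ), b), true) =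
          ∑' j : ℕ, g ((a + j, b), true) + ∑' j : ℕ, g ((a + j, b + 1), false) := by
        rw [← Summable.tsum_add, ← Summable.tsum_add]
        · congr 1; ext j
          have := hc (a + j) b
          push_cast
          rw [← add_assoc]; exact this
        · exact summable_of_finite_support (fin_comp hg (inj a b true))
        · exact summable_of_finite_support (fin_comp hg (inj a (b + 1) false))
        · exact summable_of_finite_support (fin_comp hg (inj a b false))
        · exact summable_of_finite_support (fin_comp hg (inj' a b true))
      simp only [Nat.cast_zero, add_zero] at h1
      linarith
  · intro b hb a
    simp [hb]

def Nice (Λ : Finset Site) : Prop := ∀ a b : ℤ, (a, b) ∉ Λ →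
  (∀ n : ℕ, (a, b + n) ∉ Λ) ∨ (∀ n : ℕ, (a, b - n) ∉ Λ)

lemma bdd (Λ : Finset Site) : ∃ M : ℕ, ∀ x ∈ Λ, |x.1| < M ∧ |x.2| < M := by
  refine ⟨∑ x ∈ Λ, (x.1.natAbs + x.2.natAbs) + 1, fun x hx => ?_⟩
  have := Finset.single_le_sum (f := fun x : Site => x.1.natAbs + x.2.natAbs) (fun _ _ => Nat.zero_le _) hx
  constructor <;> zify at this ⊢ <;> have := abs_nonneg x.1 <;> have := abs_nonneg x.2 <;> linarith

/-- sub-configuration -/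
def sub (g g' : Edge → ℤ) : Prop := ∀ f, g f = 0 ∨ g f = g' f

lemma comp_exists {Λ : Finset Site} (hΛ : Nice Λ) {η : Site → ℤ} (hη : Om Λ η) {e : Edge}
    (he : dd η e ≠ 0) : ∃ χ, Om Λ χ ∧ conn (dd χ) ∧ dd χ e ≠ 0 ∧ sub (dd χ) (dd η) := by
  set S := Function.support (dd η) with hS
  set γ : Set Edge := {f | Relation.ReflTransGen (RS S) e f} with hγ
  have hγS : γ ⊆ S := by
    intro f hf
    rcases Relation.ReflTransGen.cases_tail hf with h | ⟨c, _, h⟩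
    · subst h; exact he
    · exact h.2.2
  set g : Edge → ℤ := fun f => if f ∈ γ then dd η f else 0 with hg
  have hsg : Function.support g = γ := by
    ext f
    simp only [hg, Function.mem_support]
    constructor
    · intro h; by_contra hc; simp [hc] at h
    · intro h; rw [if_pos h]; exact hγS h
  have hsub : sub g (dd η) := by
    intro f; simp only [hg]; split_ifs <;> simp
  have hcl : closed g := by
    intro a b
    have h0 := closed_dd η a b
    have hmem : ∀ f ∈ pl (a, b), f ∈ γ → ∀ f' ∈ pl (a, b), g f' = dd η f' := by
      intro f hf hfγ f' hf'
      simp only [hg]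
      by_cases h : dd η f' = 0
      · rw [h, ite_self]
      · rw [if_pos]
        exact Relation.ReflTransGen.tail hfγ ⟨⟨(a, b), hf, hf'⟩, hγS hfγ, h⟩
    by_cases hex : ∃ f ∈ pl (a, b), f ∈ γ
    · obtain ⟨f, hf, hfγ⟩ := hex
      have := hmem f hf hfγ
      rw [this _ (by simp [pl]), this _ (by simp [pl]), this _ (by simp [pl]), this _ (by simp [pl])]
      exact h0
    · push Not at hex
      have : ∀ f ∈ pl (a, b), g f = 0 := fun f hf => by simp only [hg]; rw [if_neg (hex f hf)]
      rw [this _ (by simp [pl]), this _ (by simp [pl]), this _ (by simp [pl]), this _ (by simp [pl])]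
  have hfin : (Function.support g).Finite := by
    rw [hsg]; exact hη.fs.subset hγS
  obtain ⟨χ, hχ, hz⟩ := potential hcl hfin
  refine ⟨χ, ?_, ?_, ?_, ?_⟩
  · obtain ⟨M, hM⟩ := bdd Λ
    have hrow : ∀ b : ℤ, (M : ℤ) ≤ |b| → ∀ a, χ (a, b) = 0 := by
      intro b hb
      apply hz
      intro a
      have h0 : ∀ a', η (a', b) = 0 := by
        intro a'; apply hη; intro hm; have := (hM _ hm).2; simp only at this; linarith
      have : dd η ((a, b), false) = 0 := by simp [dd, nb, h0]
      rcases hsub ((a, b), false) with h | h <;> simp [h, this]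
    have hstep : ∀ a b : ℤ, (a, b) ∉ Λ → (a, b + 1) ∉ Λ → χ (a, b + 1) = χ (a, b) := by
      intro a b h1 h2
      have h3 : dd η ((a, b), true) = 0 := by simp [dd, nb, hη _ h1, hη _ h2]
      have h4 : g ((a, b), true) = 0 := by
        rcases hsub ((a, b), true) with h | h <;> simp [h, h3]
      rw [← hχ] at h4
      simp only [dd, nb, if_true] at h4
      linarith
    rintro ⟨a, b⟩ hx
    rcases hΛ a b hx with h | h
    · have : ∀ n : ℕ, χ (a, b + n) = χ (a, b) := by
        intro n
        induction n with
        | zero => simp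
        | succ n ih =>
          rw [← ih]; push_cast; rw [← add_assoc]
          apply hstep _ _ (h n)
          have := h (n + 1); push_cast at this; rwa [← add_assoc] at this
      rw [← this (M + b.natAbs)]
      apply hrow
      have : |b| = b.natAbs := by simp
      rcases abs_cases b with h | h <;> push_cast <;> rw [abs_of_nonneg] <;> omega
    · have : ∀ n : ℕ, χ (a, b - n) = χ (a, b) := by
        intro n
        induction n with
        | zero => simp
        | succ n ih =>
          rw [← ih]; push_cast
          have h5 := h (n + 1); push_cast at h5
          have := hstep a (b - (n + 1)) h5 (by have := h n; ring_nf at this ⊢; exact this)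
          rw [← this]; congr 2; ring
      rw [← this (M + b.natAbs)]
      apply hrow
      rcases abs_cases b with h | h <;> push_cast <;> rw [abs_of_nonpos] <;> omega
  · rw [hχ]
    have hp : ∀ f ∈ γ, Relation.ReflTransGen (RS γ) e f := by
      intro f hf
      induction hf with
      | refl => exact Relation.ReflTransGen.refl
      | tail h1 h2 ih => exact ih.tail ⟨h2.1, h1, h1.tail h2⟩
    have hsym : Std.Symm (RS γ) := ⟨fun a b h => ⟨eadj_symm h.1, h.2.2, h.2.1⟩⟩
    intro f hf f' hf'
    rw [hsg] at *
    exact ((Relation.ReflTransGen.stdSymm (r := RS γ)).symm _ _ (hp f hf)).trans (hp f' hf')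
  · rw [hχ, ← Function.mem_support, hsg]; exact Relation.ReflTransGen.refl
  · rw [hχ]; exact hsub

lemma first_jump {f : ℕ → ℤ} (h0 : f 0 ≠ 0) (h : ∃ n, f n = 0) :
    ∃ j, (∀ i ≤ j, f i = f 0) ∧ f (j + 1) - f j ≠ 0 := by
  have hex : ∃ n, f n ≠ f 0 := by
    obtain ⟨n, hn⟩ := h; exact ⟨n, by rw [hn]; exact h0.symm⟩
  have h1 := Nat.find_spec hex
  obtain ⟨j, hj⟩ : ∃ j, Nat.find hex = j + 1 := by
    apply Nat.exists_eq_succ_of_ne_zero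
    intro h; rw [h] at h1; exact h1 rfl
  have h2 : ∀ i ≤ j, f i = f 0 := by
    intro i hi
    have := Nat.find_min hex (m := i) (by omega)
    simpa using this
  refine ⟨j, h2, ?_⟩
  rw [h2 j le_rfl, ← hj]
  exact sub_ne_zero.2 h1

lemma jump_h {Λ : Finset Site} {χ : Site → ℤ} (hχ : Om Λ χ) {a b : ℤ} (h : χ (a, b) ≠ 0) :
    ∃ j : ℕ, (∀ i : ℕ, i ≤ j → χ (a + i, b) ≠ 0) ∧ dd χ ((a + j, b), false) ≠ 0 := by
  obtain ⟨M, hM⟩ := bdd Λ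
  obtain ⟨j, h1, h2⟩ := first_jump (f := fun j : ℕ => χ (a + j, b)) (by simpa using h)
    ⟨M + a.natAbs, by
      apply hχ; intro hm
      have := (hM _ hm).1
      rcases abs_cases a with h | h <;> push_cast at this <;> rw [abs_of_nonneg] at this <;> omega⟩
  refine ⟨j, fun i hi => ?_, ?_⟩
  · have := h1 i hi; simp only [Nat.cast_zero, add_zero] at this; rw [this]; exact h
  · simpa [dd, nb, add_assoc] using h2

lemma jump_v {Λ : Finset Site} {χ : Site → ℤ} (hχ : Om Λ χ) {a b : ℤ} (h : χ (a, b) ≠ 0) :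
    ∃ j : ℕ, dd χ ((a, b + j), true) ≠ 0 := by
  obtain ⟨M, hM⟩ := bdd Λ
  obtain ⟨j, h1, h2⟩ := first_jump (f := fun j : ℕ => χ (a, b + j)) (by simpa using h)
    ⟨M + b.natAbs, by
      apply hχ; intro hm
      have := (hM _ hm).2
      rcases abs_cases b with h | h <;> push_cast at this <;> rw [abs_of_nonneg] at this <;> omega⟩
  refine ⟨j, ?_⟩
  · simpa [dd, nb, add_assoc] using h2

lemma one_le_sq_int {m : ℤ} (h : m ≠ 0) : (1 : ℝ) ≤ (m : ℝ) ^ 2 := by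
  have : 1 ≤ m ^ 2 := by have := sq_pos_of_ne_zero (a := m) h; omega
  exact_mod_cast this

lemma J_lemma {Λ : Finset Site} {χ : Site → ℤ} (hχ : Om Λ χ) {a b : ℤ} (h : χ (a, b) ≠ 0) :
    ∃ j : ℕ, dd χ ((a + j, b), false) ≠ 0 ∧ (j : ℝ) + 1 ≤ HH χ := by
  obtain ⟨j, h1, h2⟩ := jump_h hχ h
  refine ⟨j, h2, ?_⟩
  have : ∀ i : ℕ, ∃ k : ℤ, i ≤ j → dd χ ((a + i, k), true) ≠ 0 := by
    intro i
    by_cases hi : i ≤ j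
    · obtain ⟨k, hk⟩ := jump_v hχ (h1 i hi); exact ⟨b + k, fun _ => hk⟩
    · exact ⟨0, fun h => absurd h hi⟩
  choose k hk using this
  have inj : Function.Injective (fun i : ℕ => (((a + i, k i), true) : Edge)) := by
    intro i i' h; simp at h; exact h.1
  have := sum_le_HH hχ.fs ((Finset.range (j + 1)).map ⟨_, inj⟩)
  rw [Finset.sum_map] at this
  refine le_trans ?_ this
  calc (j : ℝ) + 1 = ∑ i ∈ Finset.range (j + 1), (1 : ℝ) := by simp
    _ ≤ _ := by
      apply Finset.sum_le_sum
      intro i hi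
      simp only [Finset.mem_range] at hi
      exact one_le_sq_int (hk i (by omega))

lemma dd_inj {Λ : Finset Site} {χ : Site → ℤ} (hχ : Om Λ χ) (h : ∀ e, dd χ e = 0) : χ = 0 := by
  ext ⟨a, b⟩
  by_contra hc
  obtain ⟨j, h1, _⟩ := J_lemma hχ hc
  exact h1 (h _)

lemma Om.add {Λ : Finset Site} {η ξ : Site → ℤ} (h : Om Λ η) (h' : Om Λ ξ) : Om Λ (η + ξ) :=
  fun x hx => by simp [h x hx, h' x hx]
lemma Om.sub {Λ : Finset Site} {η ξ : Site → ℤ} (h : Om Λ η) (h' : Om Λ ξ) : Om Λ (η - ξ) :=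
  fun x hx => by simp [h x hx, h' x hx]

lemma HH_sub {χ η : Site → ℤ} (h1 : FS χ) (h2 : FS η) (h : sub (dd χ) (dd η)) :
    HH η = HH χ + HH (η - χ) := by
  unfold HH
  rw [← h1.summable.tsum_add (h2.sub h1).summable]
  congr 1; ext e
  rw [dd_sub]
  rcases h e with h | h <;> rw [h] <;> simp

lemma sub_trans' {χ η ξ : Site → ℤ} (h : sub (dd χ) (dd η)) (h' : sub (dd ξ) (dd (η - χ))) :
    sub (dd ξ) (dd η) := by
  intro f
  have e := dd_sub η χ f
  have h1 := h f
  have h2 := h' f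
  omega

lemma sub_add' {χ η ξ : Site → ℤ} (h : sub (dd χ) (dd η)) (h' : sub (dd ξ) (dd (η - χ))) :
    sub (dd (χ + ξ)) (dd η) := by
  intro f
  have e := dd_sub η χ f
  rw [dd_add]
  have h1 := h f
  have h2 := h' f
  omega

lemma supp_lt {χ η : Site → ℤ} (h2 : FS η) (h : sub (dd χ) (dd η)) {e : Edge}
    (he : dd χ e ≠ 0) : (Function.support (dd (η - χ))).ncard < (Function.support (dd η)).ncard := by
  apply Set.ncard_lt_ncard _ h2
  rw [Set.ssubset_iff_of_subset]
  · refine ⟨e, ?_, ?_⟩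
    · rcases h e with h | h
      · exact absurd h he
      · rw [Function.mem_support, ← h]; exact he
    · rcases h e with h | h
      · exact absurd h he
      · simp only [Function.mem_support, not_not]; rw [dd_sub, h, sub_self]
  · intro f hf
    simp only [Function.mem_support] at hf ⊢
    intro h0
    apply hf; rw [dd_sub, h0]
    rcases h f with h | h <;> simp [h, h0]

lemma exists_pol {Λ : Finset Site} (hΛ : Nice Λ) (n : ℕ) : ∀ {η : Site → ℤ}, Om Λ η →
    (Function.support (dd η)).ncard ≤ n → ∀ {x : Site}, η x ≠ 0 →
    ∃ χ, Om Λ χ ∧ conn (dd χ) ∧ χ x ≠ 0 ∧ sub (dd χ) (dd η) := by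
  induction n with
  | zero =>
    intro η hη hn x hx
    obtain ⟨j, h1, _⟩ := J_lemma hη (a := x.1) (b := x.2) hx
    exfalso
    have : (Function.support (dd η)).ncard = 0 := by omega
    rw [Set.ncard_eq_zero hη.fs] at this
    have h2 : ((x.1 + j, x.2), false) ∈ Function.support (dd η) := h1
    rw [this] at h2; exact h2
  | succ n ih =>
    intro η hη hn x hx
    obtain ⟨j, h1, _⟩ := J_lemma hη (a := x.1) (b := x.2) hx
    obtain ⟨χ, c1, c2, c3, c4⟩ := comp_exists hΛ hη h1
    by_cases hc : χ x = 0
    · have hlt := supp_lt hη.fs c4 c3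
      obtain ⟨ξ, d1, d2, d3, d4⟩ := ih (hη.sub c1) (by omega) (x := x) (by simpa [hc] using hx)
      exact ⟨ξ, d1, d2, d3, sub_trans' c4 d4⟩
    · exact ⟨χ, c1, c2, hc, c4⟩

def Pol (Λ N : Finset Site) (χ : Site → ℤ) : Prop := Om Λ χ ∧ conn (dd χ) ∧ ∃ x ∈ N, χ x ≠ 0

lemma Om_sum {Λ : Finset Site} (Γ : Finset (Site → ℤ)) (h : ∀ χ ∈ Γ, Om Λ χ) : Om Λ (∑ χ ∈ Γ, χ) := by
  intro x hx
  rw [Finset.sum_apply]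
  exact Finset.sum_eq_zero fun χ hχ => h χ hχ x hx

lemma decomp {Λ : Finset Site} (hΛ : Nice Λ) (N : Finset Site) (n : ℕ) : ∀ {η : Site → ℤ}, Om Λ η →
    (Function.support (dd η)).ncard ≤ n → ∃ Γ : Finset (Site → ℤ),
      (∀ χ ∈ Γ, Pol Λ N χ ∧ sub (dd χ) (dd η)) ∧ sub (dd (∑ χ ∈ Γ, χ)) (dd η) ∧
      HH (∑ χ ∈ Γ, χ) = ∑ χ ∈ Γ, HH χ ∧ ∀ x ∈ N, (η - ∑ χ ∈ Γ, χ) x = 0 := by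
  have hH0 : HH 0 = 0 := by simp [HH, dd]
  have hs0 : ∀ η, sub (dd 0) (dd η) := by intro η f; left; simp [dd]
  induction n with
  | zero =>
    intro η hη hn
    have : (Function.support (dd η)).ncard = 0 := by omega
    rw [Set.ncard_eq_zero hη.fs, Function.support_eq_empty_iff] at this
    have h0 := dd_inj hη (fun e => congrFun this e)
    refine ⟨∅, ?_⟩
    simp [h0, hH0, hs0]
  | succ n ih =>
    intro η hη hn
    by_cases hex : ∃ x ∈ N, η x ≠ 0
    swap
    · push Not at hex
      refine ⟨∅, ?_⟩
      simpa [hH0, hs0] using hex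
    obtain ⟨x, hxN, hx⟩ := hex
    obtain ⟨χ, c1, c2, c3, c4⟩ := exists_pol hΛ (n + 1) hη hn hx
    obtain ⟨j, h1, _⟩ := J_lemma c1 (a := x.1) (b := x.2) c3
    have hlt := supp_lt hη.fs c4 h1
    obtain ⟨Γ, d1, d2, d3, d4⟩ := ih (hη.sub c1) (by omega)
    have hn : χ ∉ Γ := by
      intro hm
      have := (d1 _ hm).2 ((x.1 + j, x.2), false)
      rw [dd_sub] at this
      rcases c4 ((x.1 + j, x.2), false) with h | h
      · exact h1 h
      · rw [← h] at this; simp at this; exact h1 this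
    have hOm := Om_sum Γ (fun χ h => (d1 χ h).1.1)
    refine ⟨insert χ Γ, ?_, ?_, ?_, ?_⟩
    · intro ξ hξ
      rcases Finset.mem_insert.1 hξ with rfl | hξ
      · exact ⟨⟨c1, c2, x, hxN, c3⟩, c4⟩
      · exact ⟨(d1 ξ hξ).1, sub_trans' c4 (d1 ξ hξ).2⟩
    · rw [Finset.sum_insert hn]; exact sub_add' c4 d2
    · rw [Finset.sum_insert hn, Finset.sum_insert hn, ← d3]
      have : sub (dd χ) (dd (χ + ∑ ξ ∈ Γ, ξ)) := by
        intro f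
        have e := dd_sub η χ f
        rw [dd_add]
        rcases d2 f with h | h
        · right; rw [h]; simp
        · rcases c4 f with h' | h'
          · left; exact h'
          · right; rw [h, e, h']; simp
      rw [HH_sub c1.fs (c1.add hOm).fs this]
      congr 2; abel
    · intro y hy
      rw [Finset.sum_insert hn, ← d4 y hy]
      simp only [Pi.sub_apply, Pi.add_apply]; ring

lemma decomp' {Λ : Finset Site} (hΛ : Nice Λ) (N : Finset Site) {η : Site → ℤ} (hη : Om Λ η) :
    ∃ Γ : Finset (Site → ℤ), ∃ η' : Site → ℤ, (∀ χ ∈ Γ, Pol Λ N χ) ∧ η = (∑ χ ∈ Γ, χ) + η' ∧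
      Om Λ (∑ χ ∈ Γ, χ) ∧ Om Λ η' ∧ (∀ x ∈ N, η' x = 0) ∧ HH (∑ χ ∈ Γ, χ) = ∑ χ ∈ Γ, HH χ ∧
      HH η = HH (∑ χ ∈ Γ, χ) + HH η' := by
  obtain ⟨Γ, h1, h2, h3, h4⟩ := decomp hΛ N _ hη le_rfl
  have hOm := Om_sum Γ (fun χ h => (h1 χ h).1.1)
  exact ⟨Γ, η - ∑ χ ∈ Γ, χ, fun χ h => (h1 χ h).1, by abel, hOm, hη.sub hOm, h4, h3,
    HH_sub hOm.fs hη.fs h2⟩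

lemma exists_mu : ∃ μ : MeasureTheory.Measure ℤ, MeasureTheory.IsProbabilityMeasure μ ∧
    ∃ K : ℝ, 0 ≤ K ∧ ∀ m : ℤ, ENNReal.ofReal (Real.exp (-(K + (m : ℝ) ^ 2))) ≤ μ {m} := by
  have hsum : Summable (fun m : ℤ => (1 / 2 : ℝ) ^ m.natAbs) := by
    apply Summable.of_nat_of_neg <;> simpa using summable_geometric_two
  set c := ∑' m : ℤ, (1 / 2 : ℝ) ^ m.natAbs with hc
  have hc1 : 1 ≤ c := by
    have := hsum.le_tsum 0 (fun _ _ => by positivity)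
    simp only [Int.natAbs_zero, pow_zero] at this
    exact this
  set w : ℤ → ENNReal := fun m => ENNReal.ofReal ((1 / 2 : ℝ) ^ m.natAbs) with hw
  have hC : tsum w = ENNReal.ofReal c := by
    rw [hc, ENNReal.ofReal_tsum_of_nonneg (fun _ => by positivity) hsum]
  have h0 : tsum w ≠ 0 := by rw [hC]; simp; linarith
  have hT : tsum w ≠ ⊤ := by rw [hC]; simp
  refine ⟨(PMF.normalize w h0 hT).toMeasure, inferInstance, Real.log c, Real.log_nonneg hc1, ?_⟩
  intro m
  rw [PMF.toMeasure_apply_singleton _ _ (measurableSet_singleton _), PMF.normalize_apply]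
  change _ ≤ w m * (tsum w)⁻¹
  rw [hC, ← ENNReal.ofReal_inv_of_pos (by linarith), ← ENNReal.ofReal_mul (by positivity)]
  apply ENNReal.ofReal_le_ofReal
  rw [neg_add, Real.exp_add, Real.exp_neg, Real.exp_log (by linarith), mul_comm]
  apply mul_le_mul_of_nonneg_right _ (by positivity)
  have h1 : Real.exp (-1) ≤ 1 / 2 := by
    rw [Real.exp_neg, one_div]
    apply inv_anti₀ (by norm_num)
    linarith [Real.exp_one_gt_d9]
  have h2 : (m.natAbs : ℝ) ≤ (m : ℝ) ^ 2 := by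
    have : (m.natAbs : ℤ) ≤ m ^ 2 := by
      rw [← Int.natAbs_sq, sq]
      rcases Nat.eq_zero_or_pos m.natAbs with h | h
      · simp [h]
      · nlinarith
    have h3 : ((m.natAbs : ℤ) : ℝ) ≤ ((m ^ 2 : ℤ) : ℝ) := Int.cast_le.2 this
    rw [Int.cast_natCast, Int.cast_pow] at h3; exact h3
  calc Real.exp (-(m : ℝ) ^ 2) ≤ Real.exp (-(m.natAbs : ℝ)) := Real.exp_le_exp.2 (by linarith)
    _ = Real.exp (-1) ^ m.natAbs := by rw [← Real.exp_nat_mul]; ring_nf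
    _ ≤ _ := by gcongr

def FV (χ : Site → ℤ) : Prop := ∃ Λ, Om Λ χ

lemma FV.fs {χ : Site → ℤ} (h : FV χ) : FS χ := by obtain ⟨Λ, h⟩ := h; exact h.fs

def FS.fin {χ : Site → ℤ} (h : FS χ) : Finset Edge :=
  Set.Finite.toFinset (s := Function.support (dd χ)) h

lemma FS.mem_fin {χ : Site → ℤ} (h : FS χ) (e : Edge) : e ∈ h.fin ↔ dd χ e ≠ 0 := by
  exact Set.Finite.mem_toFinset (s := Function.support (dd χ)) h

lemma HH_eq_sum {χ : Site → ℤ} (h : FS χ) : HH χ = ∑ e ∈ h.fin, ((dd χ e : ℤ) : ℝ) ^ 2 := by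
  unfold HH
  apply tsum_eq_sum
  intro e he
  have : dd χ e = 0 := by by_contra hc; apply he; rw [h.mem_fin]; exact hc
  simp [this]

lemma dd_inj' {χ χ' : Site → ℤ} (h : FV χ) (h' : FV χ') (hd : ∀ e, dd χ e = dd χ' e) : χ = χ' := by
  obtain ⟨Λ, h⟩ := h
  obtain ⟨Λ', h'⟩ := h'
  have : Om (Λ ∪ Λ') (χ - χ') := by
    intro x hx
    simp only [Finset.mem_union, not_or] at hx
    simp [h x hx.1, h' x hx.2]
  have := dd_inj this (fun e => by rw [dd_sub, hd, sub_self])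
  exact sub_eq_zero.1 this

lemma perc : ∃ b : ℝ, 0 ≤ b ∧ ∀ e0 : Edge, ∑' χ : Site → ℤ,
    (if FV χ ∧ conn (dd χ) ∧ dd χ e0 ≠ 0 then ENNReal.ofReal (Real.exp (-b * HH χ)) else 0) ≤ 1 := by
  obtain ⟨μ, hμ, K, hK, hm⟩ := exists_mu
  refine ⟨9 * K + 1, by positivity, fun e0 => ?_⟩
  set I := {χ : Site → ℤ // FV χ ∧ conn (dd χ) ∧ dd χ e0 ≠ 0} with hI
  set S : I → Finset Edge := fun χ => χ.2.1.fs.fin with hS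
  have memS : ∀ χ : I, ∀ e, e ∈ S χ ↔ dd χ.1 e ≠ 0 := by
    intro χ e; exact FS.mem_fin _ e
  set T : I → Finset Edge := fun χ => S χ ∪ (S χ).biUnion nbrs with hT
  set A : I → Set (Edge → ℤ) := fun χ => Set.pi (T χ) (fun e => {dd χ.1 e}) with hA
  set P := MeasureTheory.Measure.infinitePi (fun _ : Edge => μ) with hP
  have hmA : ∀ χ, MeasurableSet (A χ) := fun χ =>
    MeasurableSet.pi (Finset.countable_toSet _) (fun _ _ => measurableSet_singleton _)
  have half : ∀ χ χ' : I, ∀ ω, ω ∈ A χ → ω ∈ A χ' → ∀ e, dd χ.1 e ≠ 0 →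
      dd χ'.1 e = dd χ.1 e := by
    intro χ χ' ω h h' e he
    have hp := χ.2.2.1 e0 χ.2.2.2 e he
    have hTS : ∀ χ : I, ∀ f, f ∈ S χ → f ∈ T χ := fun χ f hf => Finset.mem_union_left _ hf
    have key : ∀ f, f ∈ S χ → f ∈ T χ' → dd χ'.1 f = dd χ.1 f := by
      intro f hf hf'
      have h1 := h f (hTS χ f hf)
      have h2 := h' f hf'
      simp only [Set.mem_singleton_iff] at h1 h2
      rw [← h1, ← h2]
    have : e ∈ S χ' := by
      clear he
      induction hp with
      | refl => rw [memS]; exact χ'.2.2.2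
      | tail h1 h2 ih =>
        rename_i b c
        have hc : c ∈ S χ := (memS _ _).2 h2.2.2
        have hT' : c ∈ T χ' := by
          apply Finset.mem_union_right
          rw [Finset.mem_biUnion]
          exact ⟨b, ih, mem_nbrs h2.1⟩
        rw [memS, key c hc hT', ← memS]; exact hc
    exact key e ((memS _ _).2 he) (hTS _ _ this)
  have hdisj : Pairwise (Function.onFun Disjoint A) := by
    intro χ χ' hne
    rw [Function.onFun, Set.disjoint_left]
    intro ω h h'
    apply hne
    apply Subtype.ext
    apply dd_inj' χ.2.1 χ'.2.1
    intro e
    by_cases h1 : dd χ.1 e = 0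
    · by_cases h2 : dd χ'.1 e = 0
      · rw [h1, h2]
      · exact half χ' χ ω h' h e h2
    · exact (half χ χ' ω h h' e h1).symm
  have hle : ∀ χ : I, ENNReal.ofReal (Real.exp (-(9 * K + 1) * HH χ.1)) ≤ P (A χ) := by
    intro χ
    rw [hA, hP, MeasureTheory.Measure.infinitePi_pi _ (fun _ _ => measurableSet_singleton _)]
    refine le_trans ?_ (Finset.prod_le_prod' (fun e _ => hm (dd χ.1 e)))
    rw [← ENNReal.ofReal_prod_of_nonneg (fun _ _ => Real.exp_nonneg _), ← Real.exp_sum]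
    apply ENNReal.ofReal_le_ofReal
    apply Real.exp_le_exp.2
    rw [Finset.sum_neg_distrib, Finset.sum_add_distrib, Finset.sum_const, nsmul_eq_mul]
    have h1 := sum_le_HH χ.2.1.fs (T χ)
    have h2 : ((S χ).card : ℝ) ≤ HH χ.1 := by
      rw [HH_eq_sum χ.2.1.fs]
      calc ((S χ).card : ℝ) = ∑ e ∈ S χ, (1 : ℝ) := by simp
        _ ≤ _ := Finset.sum_le_sum fun e he => one_le_sq_int ((memS _ _).1 he)
    have h3 : (T χ).card ≤ 9 * (S χ).card := by
      have := Finset.card_union_le (S χ) ((S χ).biUnion nbrs)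
      have h4 := Finset.card_biUnion_le_card_mul (S χ) nbrs 8 (fun e _ => nbrs_card e)
      simp only [hT]
      omega
    have h3' : ((T χ).card : ℝ) ≤ 9 * (S χ).card := by exact_mod_cast h3
    nlinarith
  calc _ = ∑' χ : I, ENNReal.ofReal (Real.exp (-(9 * K + 1) * HH χ.1)) := by
        have := tsum_subtype {χ : Site → ℤ | FV χ ∧ conn (dd χ) ∧ dd χ e0 ≠ 0}
          (fun χ => ENNReal.ofReal (Real.exp (-(9 * K + 1) * HH χ)))
        refine Eq.trans ?_ this.symm
        refine tsum_congr fun χ => ?_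
        rw [Set.indicator_apply]; rfl
    _ ≤ ∑' χ, P (A χ) := ENNReal.tsum_le_tsum hle
    _ ≤ P (⋃ χ, A χ) := MeasureTheory.tsum_meas_le_meas_iUnion_of_disjoint P hmA hdisj
    _ ≤ 1 := MeasureTheory.prob_le_one

lemma perc1 : ∃ b : ℝ, 1 ≤ b ∧ ∀ x : Site, ∑' χ : Site → ℤ,
    (if FV χ ∧ conn (dd χ) ∧ χ x ≠ 0 then ENNReal.ofReal (Real.exp (-b * HH χ)) else 0) ≤ 1 := by
  obtain ⟨b, hb, h⟩ := perc
  refine ⟨b + 1, by linarith, fun x => ?_⟩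
  set q : ℕ → (Site → ℤ) → ENNReal := fun j χ =>
    if FV χ ∧ conn (dd χ) ∧ dd χ ((x.1 + j, x.2), false) ≠ 0 then
      ENNReal.ofReal (Real.exp (-b * HH χ)) else 0 with hq
  calc _ ≤ ∑' χ : Site → ℤ, ∑' j : ℕ, ENNReal.ofReal ((1 / 2) ^ (j + 1)) * q j χ := by
        refine ENNReal.tsum_le_tsum fun χ => ?_
        by_cases hc : FV χ ∧ conn (dd χ) ∧ χ x ≠ 0
        swap
        · rw [if_neg hc]; exact zero_le
        rw [if_pos hc]
        obtain ⟨⟨Λ, h1⟩, h2, h3⟩ := hc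
        obtain ⟨j, h4, h5⟩ := J_lemma h1 (a := x.1) (b := x.2) h3
        refine le_trans ?_ (ENNReal.le_tsum j)
        simp only [hq]
        rw [if_pos ⟨⟨Λ, h1⟩, h2, h4⟩, ← ENNReal.ofReal_mul (by positivity)]
        apply ENNReal.ofReal_le_ofReal
        have : Real.exp (-1) ≤ 1 / 2 := by
          rw [Real.exp_neg, one_div]
          apply inv_anti₀ (by norm_num)
          linarith [Real.exp_one_gt_d9]
        calc Real.exp (-(b + 1) * HH χ) ≤ Real.exp (-((j : ℝ) + 1)) * Real.exp (-b * HH χ) := by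
              rw [← Real.exp_add]; apply Real.exp_le_exp.2; linarith
          _ = Real.exp (-1) ^ (j + 1) * Real.exp (-b * HH χ) := by
              rw [← Real.exp_nat_mul]; push_cast; ring_nf
          _ ≤ _ := by gcongr
    _ = ∑' j : ℕ, ENNReal.ofReal ((1 / 2) ^ (j + 1)) * ∑' χ : Site → ℤ, q j χ := by
        rw [ENNReal.tsum_comm]
        refine tsum_congr fun j => ?_
        rw [ENNReal.tsum_mul_left]
    _ ≤ ∑' j : ℕ, ENNReal.ofReal ((1 / 2) ^ (j + 1)) := by
        refine ENNReal.tsum_le_tsum fun j => ?_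
        exact mul_le_of_le_one_right' (h _)
    _ ≤ 1 := by
        have hs : Summable (fun j : ℕ => (1 / 2 : ℝ) ^ (j + 1)) := by
          simpa [pow_succ] using summable_geometric_two.mul_right (1 / 2 : ℝ)
        rw [← ENNReal.ofReal_tsum_of_nonneg (fun _ => by positivity) hs]
        have : ∑' j : ℕ, (1 / 2 : ℝ) ^ (j + 1) = 1 := by
          simp only [pow_succ]
          rw [tsum_mul_right, tsum_geometric_two]; norm_num
        rw [this]; simp

def b1 : ℝ := Classical.choose perc1
lemma one_le_b1 : 1 ≤ b1 := (Classical.choose_spec perc1).1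
lemma b1_spec (x : Site) : ∑' χ : Site → ℤ,
    (if FV χ ∧ conn (dd χ) ∧ χ x ≠ 0 then ENNReal.ofReal (Real.exp (-b1 * HH χ)) else 0) ≤ 1 :=
  (Classical.choose_spec perc1).2 x

lemma sum_fin_prod {α : Type*} (p : α → ENNReal) (n : ℕ) (hp : ∑' a, p a ≤ n) :
    ∑' Γ : Finset α, ∏ a ∈ Γ, p a ≤ ENNReal.ofReal (Real.exp n) := by
  have hfin : ∀ a, p a ≠ ⊤ := fun a =>
    ne_top_of_le_ne_top (ENNReal.natCast_ne_top n) ((ENNReal.le_tsum a).trans hp)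
  rw [ENNReal.tsum_eq_iSup_sum]
  refine iSup_le fun G => ?_
  set U : Finset α := G.sup id with hU
  have h1 : G ⊆ U.powerset := by
    intro Γ hΓ
    rw [Finset.mem_powerset]
    exact Finset.le_sup (f := id) hΓ
  calc _ ≤ ∑ Γ ∈ U.powerset, ∏ a ∈ Γ, p a := Finset.sum_le_sum_of_subset h1
    _ = ∏ a ∈ U, (1 + p a) := by
        rw [Finset.prod_one_add]
    _ ≤ ∏ a ∈ U, ENNReal.ofReal (Real.exp (p a).toReal) := by
        refine Finset.prod_le_prod' fun a _ => ?_
        rw [← ENNReal.ofReal_toReal (hfin a), ENNReal.toReal_ofReal ENNReal.toReal_nonneg,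
          ← ENNReal.ofReal_one, ← ENNReal.ofReal_add zero_le_one ENNReal.toReal_nonneg]
        apply ENNReal.ofReal_le_ofReal
        linarith [Real.add_one_le_exp (p a).toReal]
    _ = ENNReal.ofReal (Real.exp (∑ a ∈ U, (p a).toReal)) := by
        rw [← ENNReal.ofReal_prod_of_nonneg (fun _ _ => Real.exp_nonneg _), ← Real.exp_sum]
    _ ≤ _ := by
        apply ENNReal.ofReal_le_ofReal
        apply Real.exp_le_exp.2
        rw [← ENNReal.toReal_sum (fun a _ => hfin a)]
        have := ENNReal.toReal_mono (ENNReal.natCast_ne_top n) ((ENNReal.sum_le_tsum U).trans hp)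
        simpa using this

def pw (N : Finset Site) (χ : Site → ℤ) : ENNReal :=
  if FV χ ∧ conn (dd χ) ∧ ∃ x ∈ N, χ x ≠ 0 then ENNReal.ofReal (Real.exp (-b1 * HH χ)) else 0

lemma pw_sum (N : Finset Site) : ∑' χ, pw N χ ≤ (N.card : ℕ) := by
  calc ∑' χ, pw N χ ≤ ∑' χ : Site → ℤ, ∑ x ∈ N, (if FV χ ∧ conn (dd χ) ∧ χ x ≠ 0 then
          ENNReal.ofReal (Real.exp (-b1 * HH χ)) else 0) := by
        refine ENNReal.tsum_le_tsum fun χ => ?_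
        unfold pw
        by_cases h : FV χ ∧ conn (dd χ) ∧ ∃ x ∈ N, χ x ≠ 0
        · rw [if_pos h]
          obtain ⟨h1, h2, x, hx, h3⟩ := h
          refine le_trans ?_ (Finset.single_le_sum (fun _ _ => zero_le) hx)
          rw [if_pos ⟨h1, h2, h3⟩]
        · rw [if_neg h]; exact zero_le
    _ = ∑ x ∈ N, ∑' χ : Site → ℤ, (if FV χ ∧ conn (dd χ) ∧ χ x ≠ 0 then
          ENNReal.ofReal (Real.exp (-b1 * HH χ)) else 0) := by
        rw [Summable.tsum_finsetSum (fun _ _ => ENNReal.summable)]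
    _ ≤ ∑ x ∈ N, 1 := Finset.sum_le_sum fun x _ => b1_spec x
    _ = _ := by simp

lemma Pp {Λ : Finset Site} (hΛ : Nice Λ) {β : ℝ} (N : Finset Site)
    (F : (Site → ℤ) → ENNReal) (hF : ∀ η η' : Site → ℤ, (∀ x ∈ N, η x = η' x) → F η = F η')
    (κ : ENNReal) (hκ : ∀ u, Om Λ u → F u * ENNReal.ofReal (Real.exp (-(β - b1) * HH u)) ≤ κ) :
    ∑' η, F η * Wt β Λ η ≤ κ * ENNReal.ofReal (Real.exp N.card) *
      WE β Λ (fun η => ∀ x ∈ N, η x = 0) := by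
  choose Γ η' h1 h2 h3 h4 h5 h6 h7 using fun η : {η // Om Λ η} => decomp' hΛ N η.2
  set G : Finset (Site → ℤ) × (Site → ℤ) → ENNReal := fun q =>
    κ * (∏ χ ∈ q.1, pw N χ) * (if ∀ x ∈ N, q.2 x = 0 then Wt β Λ q.2 else 0) with hG
  have inj : Function.Injective (fun η : {η // Om Λ η} => (Γ η, η' η)) := by
    intro η ξ h
    simp only [Prod.mk.injEq] at h
    apply Subtype.ext
    rw [h2 η, h2 ξ, h.1, h.2]
  calc ∑' η, F η * Wt β Λ η = ∑' η : {η // Om Λ η}, F η.1 * Wt β Λ η.1 := by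
        have := tsum_subtype {η | Om Λ η} (fun η => F η * Wt β Λ η)
        refine Eq.trans ?_ this.symm
        refine tsum_congr fun η => ?_
        rw [Set.indicator_apply]
        by_cases h : Om Λ η
        · rw [if_pos (show η ∈ {η | Om Λ η} from h)]
        · rw [if_neg (show η ∉ {η | Om Λ η} from h), Wt, wR, if_neg h]; simp
    _ ≤ ∑' η : {η // Om Λ η}, G (Γ η, η' η) := by
        refine ENNReal.tsum_le_tsum fun η => ?_
        have hf : F η.1 = F (∑ χ ∈ Γ η, χ) := by
          apply hF
          intro x hx
          conv_lhs => rw [h2 η]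
          rw [Pi.add_apply, h5 η x hx, add_zero]
        have hw : Wt β Λ η.1 = ENNReal.ofReal (Real.exp (-(β - b1) * HH (∑ χ ∈ Γ η, χ))) *
            (∏ χ ∈ Γ η, pw N χ) * Wt β Λ (η' η) := by
          have : ∏ χ ∈ Γ η, pw N χ = ENNReal.ofReal (Real.exp (-b1 * HH (∑ χ ∈ Γ η, χ))) := by
            rw [h6, Finset.mul_sum, Real.exp_sum, ENNReal.ofReal_prod_of_nonneg
              (fun _ _ => Real.exp_nonneg _)]
            refine Finset.prod_congr rfl fun χ hχ => ?_
            obtain ⟨c1, c2, c3⟩ := h1 η χ hχ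
            rw [pw, if_pos ⟨⟨Λ, c1⟩, c2, c3⟩]
          rw [this, Wt, Wt, wR, wR, if_pos η.2, if_pos (h4 η), ← ENNReal.ofReal_mul (Real.exp_nonneg _),
            ← ENNReal.ofReal_mul (by positivity), ← Real.exp_add, ← Real.exp_add, h7 η]
          congr 2; ring
        simp only [hG]
        rw [if_pos (h5 η), hw, hf, ← mul_assoc, ← mul_assoc]
        gcongr
        exact hκ _ (h3 η)
    _ ≤ ∑' q, G q := ENNReal.tsum_comp_le_tsum_of_injective inj G
    _ = κ * (∑' Γ : Finset (Site → ℤ), ∏ χ ∈ Γ, pw N χ) * WE β Λ (fun η => ∀ x ∈ N, η x = 0) := by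
        rw [ENNReal.tsum_prod', WE, mul_assoc, ← ENNReal.tsum_mul_right, ← ENNReal.tsum_mul_left]
        refine tsum_congr fun Γ => ?_
        rw [← ENNReal.tsum_mul_left, ← ENNReal.tsum_mul_left]
        refine tsum_congr fun η => ?_
        simp only [hG]; rw [mul_assoc]; congr!
    _ ≤ _ := by
        gcongr
        exact sum_fin_prod _ _ (pw_sum N)

lemma HH_zero : HH 0 = 0 := by simp [HH, dd]
lemma Om_zero (Λ : Finset Site) : Om Λ 0 := fun _ _ => rfl

lemma Z_ne_top {Λ : Finset Site} (hΛ : Nice Λ) {β : ℝ} (hβ : b1 ≤ β) :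
    WE β Λ (fun _ => True) ≠ ⊤ := by
  have := Pp hΛ (β := β) Λ (fun _ => 1) (fun _ _ _ => rfl) 1 (by
    intro u _
    rw [one_mul, ← ENNReal.ofReal_one]
    apply ENNReal.ofReal_le_ofReal
    rw [← Real.exp_zero]; apply Real.exp_le_exp.2
    have := HH_nonneg u
    nlinarith)
  have h0 : WE β Λ (fun η => ∀ x ∈ Λ, η x = 0) ≤ 1 := by
    unfold WE
    rw [tsum_eq_single 0]
    · rw [if_pos (by simp), Wt, wR, if_pos (Om_zero _), HH_zero]; simp
    · intro η hη
      by_cases h : ∀ x ∈ Λ, η x = 0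
      · rw [if_pos h, Wt, wR, if_neg]
        · simp
        · intro hO; apply hη; ext x
          by_cases hx : x ∈ Λ
          · exact h x hx
          · exact hO x hx
      · rw [if_neg h]
  have h1 : WE β Λ (fun _ => True) = ∑' η, 1 * Wt β Λ η := by simp [WE]
  rw [h1]
  refine ne_top_of_le_ne_top ?_ this
  refine ENNReal.mul_ne_top (by simp) (ne_top_of_le_ne_top ENNReal.one_ne_top h0)

lemma WE_ne_top {Λ : Finset Site} (hΛ : Nice Λ) {β : ℝ} (hβ : b1 ≤ β) (A : (Site → ℤ) → Prop) :
    WE β Λ A ≠ ⊤ :=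
  ne_top_of_le_ne_top (Z_ne_top hΛ hβ) (WE_mono fun _ _ => trivial)

lemma WE_pos {Λ : Finset Site} {β : ℝ} {A : (Site → ℤ) → Prop} {η : Site → ℤ} (h : Om Λ η) (hA : A η) :
    WE β Λ A ≠ 0 := by
  have h2 : Wt β Λ η ≤ WE β Λ A := by
    refine le_trans ?_ (ENNReal.le_tsum η)
    rw [if_pos hA]
  have h3 : 0 < Wt β Λ η := by
    rw [Wt, wR, if_pos h]; simpa using Real.exp_pos _
  exact (h3.trans_le h2).ne'

lemma nice_ball (L : ℕ) : Nice (ball L) := by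
  intro a b h
  have hb : ∀ a b : ℤ, (a, b) ∈ ball L ↔ a ^ 2 + b ^ 2 ≤ (L : ℤ) ^ 2 := by
    intro a b
    simp only [ball, Finset.mem_filter, Finset.mem_product, Finset.mem_Icc, Int.ceil_natCast]
    have : ((a : ℝ) ^ 2 + (b : ℝ) ^ 2 ≤ (L : ℝ) ^ 2) ↔ a ^ 2 + b ^ 2 ≤ (L : ℤ) ^ 2 := by
      exact_mod_cast Iff.rfl
    rw [this]
    refine ⟨fun h => h.2, fun h => ⟨⟨?_, ?_⟩, h⟩⟩
    · exact abs_le.1 (abs_le_of_sq_le_sq (by nlinarith [sq_nonneg b]) (by positivity))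
    · exact abs_le.1 (abs_le_of_sq_le_sq (by nlinarith [sq_nonneg a]) (by positivity))
  rw [hb] at h
  rcases le_total 0 b with h0 | h0
  · left; intro n; rw [hb]
    have : (0 : ℤ) ≤ n := by positivity
    nlinarith
  · right; intro n; rw [hb]
    have : (0 : ℤ) ≤ n := by positivity
    nlinarith

lemma ZL_zero (β : ℝ) (Λ : Finset Site) : ZL β Λ 0 = WE β Λ (fun _ => True) := by
  simp [ZL, WE]

lemma ZL_ne_zero (β : ℝ) (Λ : Finset Site) (ℓ : (Site → ℤ) →+ ℝ) : ZL β Λ ℓ ≠ 0 := by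
  have h : ENNReal.ofReal (Real.exp (ℓ 0)) * Wt β Λ 0 ≤ ZL β Λ ℓ := ENNReal.le_tsum 0
  rw [map_zero, Wt, wR, if_pos (Om_zero Λ), HH_zero] at h
  intro h0; rw [h0] at h; simp at h

lemma amgm {x y s : ℝ} (hx : 0 ≤ x) (hy : 0 ≤ y) (h : s ^ 2 ≤ 4 * x * y) : s ≤ x + y := by
  apply le_of_abs_le
  apply abs_le_of_sq_le_sq _ (by positivity)
  nlinarith [sq_nonneg (x - y)]

lemma gauss {Λ : Finset Site} (hΛ : Nice Λ) {β : ℝ} (hβ : 2 * b1 ≤ β) (ℓ : (Site → ℤ) →+ ℝ) {E : ℝ}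
    (hE : 0 ≤ E) (h : ∀ η, Om Λ η → (ℓ η) ^ 2 ≤ E * HH η) :
    ZL β Λ ℓ ≤ ENNReal.ofReal (Real.exp (E / (2 * β))) * ZL β Λ 0 := by
  have hb := one_le_b1
  have hβ0 : 0 < β := by linarith
  set K := E / (2 * β) with hK
  set ℓk : ℕ → ((Site → ℤ) →+ ℝ) := fun k => (2 ^ k) • ℓ with hℓk
  have hfin : ∀ k, ZL β Λ (ℓk k) ≤ ENNReal.ofReal (Real.exp (4 ^ k * K)) * ZL (β / 2) Λ 0 := by
    intro k
    unfold ZL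
    rw [← ENNReal.tsum_mul_left]
    refine ENNReal.tsum_le_tsum fun η => ?_
    unfold Wt wR
    by_cases hO : Om Λ η
    swap
    · rw [if_neg hO, if_neg hO]; simp
    rw [if_pos hO, if_pos hO, ← ENNReal.ofReal_mul (by positivity), ← ENNReal.ofReal_mul (by positivity),
      ← ENNReal.ofReal_mul (by positivity)]
    apply ENNReal.ofReal_le_ofReal
    simp only [AddMonoidHom.zero_apply]
    rw [← Real.exp_add, ← Real.exp_add, ← Real.exp_add]
    apply Real.exp_le_exp.2
    have h1 : ℓk k η = 2 ^ k * ℓ η := by simp [hℓk]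
    have h2 := h η hO
    have hH := HH_nonneg η
    have h3 : ℓk k η ≤ (β / 2) * HH η + 4 ^ k * K := by
      rw [h1]
      apply amgm (by positivity) (by positivity)
      have h44 : (4 : ℝ) ^ k = 2 ^ k * 2 ^ k := by rw [← mul_pow]; norm_num
      have : 4 * (β / 2 * HH η) * (4 ^ k * K) = (2 ^ k) ^ 2 * (E * HH η) := by
        rw [hK, h44]; field_simp; norm_num
      rw [this, mul_pow]
      gcongr
    linarith
  have hZ2 : ZL (β / 2) Λ 0 ≠ ⊤ := by rw [ZL_zero]; exact Z_ne_top hΛ (by linarith)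
  have hZ : ZL β Λ 0 ≠ ⊤ := by rw [ZL_zero]; exact Z_ne_top hΛ (by linarith)
  have hkt : ∀ k, ZL β Λ (ℓk k) ≠ ⊤ := fun k =>
    ne_top_of_le_ne_top (ENNReal.mul_ne_top ENNReal.ofReal_ne_top hZ2) (hfin k)
  set z0 := (ZL β Λ 0).toReal with hz0
  have z0pos : 0 < z0 := ENNReal.toReal_pos (ZL_ne_zero _ _ _) hZ
  set a : ℕ → ℝ := fun k => (ZL β Λ (ℓk k)).toReal with ha
  have apos : ∀ k, 0 < a k := fun k => ENNReal.toReal_pos (ZL_ne_zero _ _ _) (hkt k)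
  have hstep : ∀ k, (a k / z0) ^ 4 ≤ a (k + 1) / z0 := by
    intro k
    set t := a k ^ 2 / (a (k + 1) * z0) with ht
    have tpos : 0 < t := by have := apos k; have := apos (k + 1); positivity
    have h1 := ZL_ineq β Λ (ℓk k) (ENNReal.ofReal t)
    have h2 : ℓk k + ℓk k = ℓk (k + 1) := by
      simp only [hℓk]; rw [← two_nsmul, ← mul_nsmul, pow_succ]
    rw [h2] at h1
    have h3 := ENNReal.toReal_mono (by
      refine ENNReal.add_ne_top.2 ⟨ENNReal.mul_ne_top (ENNReal.pow_ne_top ENNReal.ofReal_ne_top)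
        (ENNReal.mul_ne_top (hkt _) hZ), ENNReal.pow_ne_top hZ⟩) h1
    rw [ENNReal.toReal_add (ENNReal.mul_ne_top (ENNReal.pow_ne_top ENNReal.ofReal_ne_top)
        (ENNReal.mul_ne_top (hkt _) hZ)) (ENNReal.pow_ne_top hZ)] at h3
    simp only [ENNReal.toReal_mul, ENNReal.toReal_pow, ENNReal.toReal_ofReal tpos.le] at h3
    change (ENNReal.toReal 2) * (t * a k ^ 2) ≤ t ^ 2 * (a (k + 1) * z0) + z0 ^ 2 at h3
    rw [show ENNReal.toReal 2 = 2 by simp] at h3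
    have hA := apos (k + 1)
    have e1 : t ^ 2 * (a (k + 1) * z0) = t * a k ^ 2 := by rw [ht]; field_simp
    have e2 : t * a k ^ 2 = a k ^ 4 / (a (k + 1) * z0) := by rw [ht]; field_simp
    have h4 : a k ^ 4 / (a (k + 1) * z0) ≤ z0 ^ 2 := by rw [← e2]; linarith
    rw [div_le_iff₀ (by positivity)] at h4
    rw [div_pow, div_le_div_iff₀ (by positivity) z0pos]
    nlinarith
  have hind : ∀ k, (a 0 / z0) ^ (4 ^ k) ≤ a k / z0 := by
    intro k
    induction k with
    | zero => simp
    | succ k ih =>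
      rw [pow_succ, pow_mul]
      refine le_trans ?_ (hstep k)
      exact pow_le_pow_left₀ (by have := apos 0; positivity) ih 4
  set C := (ZL (β / 2) Λ 0).toReal / z0 with hC
  have hup : ∀ k, a k / z0 ≤ Real.exp (4 ^ k * K) * C := by
    intro k
    have := ENNReal.toReal_mono (ENNReal.mul_ne_top ENNReal.ofReal_ne_top hZ2) (hfin k)
    rw [ENNReal.toReal_mul, ENNReal.toReal_ofReal (Real.exp_nonneg _)] at this
    rw [hC, ← mul_div_assoc]
    exact div_le_div_of_nonneg_right this z0pos.le
  have hr : ∀ k, (a 0 / z0 / Real.exp K) ^ (4 ^ k) ≤ C := by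
    intro k
    rw [div_pow, div_le_iff₀ (by positivity), ← Real.exp_nat_mul, mul_comm C]
    push_cast
    exact (hind k).trans (hup k)
  have hfinal : a 0 / z0 / Real.exp K ≤ 1 := by
    by_contra hc
    push Not at hc
    obtain ⟨k, hk⟩ := exists_nat_gt (C / (a 0 / z0 / Real.exp K - 1))
    rw [div_lt_iff₀ (by linarith)] at hk
    have h1 := one_add_mul_le_pow (a := a 0 / z0 / Real.exp K - 1) (by linarith) (4 ^ k)
    have h2 := hr k
    rw [show 1 + (a 0 / z0 / Real.exp K - 1) = a 0 / z0 / Real.exp K by ring] at h1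
    have h3 : (k : ℝ) ≤ ((4 ^ k : ℕ) : ℝ) := by exact_mod_cast (Nat.lt_pow_self (by norm_num)).le
    nlinarith
  rw [div_le_one (by positivity), div_le_iff₀ z0pos] at hfinal
  have e0 : ℓk 0 = ℓ := by simp [hℓk]
  rw [← e0, ← ENNReal.ofReal_toReal (hkt 0), ← ENNReal.ofReal_toReal hZ, ← ENNReal.ofReal_mul (by positivity)]
  exact ENNReal.ofReal_le_ofReal hfinal

/-! flow lemma -/
def Av (n : ℕ) (η : Site → ℤ) : ℝ := (1 / ((n : ℝ) + 1)) * ∑ b ∈ Finset.range (n + 1), ((η ((n : ℤ), (b : ℤ)) : ℤ) : ℝ)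

def En (n : ℕ) : ℝ := ∑ a ∈ Finset.range n, 2 / ((a : ℝ) + 1)

def hA (η : Site → ℤ) (a : ℕ) : ℝ :=
  ∑ b ∈ Finset.range (a + 1), ((dd η (((a : ℤ), (b : ℤ)), false) : ℤ) : ℝ) ^ 2 +
  ∑ b ∈ Finset.range (a + 1), ((dd η (((a : ℤ) + 1, (b : ℤ)), true) : ℤ) : ℝ) ^ 2

lemma abel_sum (y : ℕ → ℝ) (m : ℕ) :
    ∑ b ∈ Finset.range m, ((b : ℝ) + 1) * (y b - y (b + 1)) = ∑ b ∈ Finset.range m, y b - m * y m := by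
  induction m with
  | zero => simp
  | succ m ih => rw [Finset.sum_range_succ, ih, Finset.sum_range_succ]; push_cast; ring

lemma Av_step (η : Site → ℤ) (a : ℕ) : (Av a η - Av (a + 1) η) ^ 2 ≤ 2 / ((a : ℝ) + 1) * hA η a := by
  set x : ℕ → ℝ := fun b => ((η ((a : ℤ), (b : ℤ)) : ℤ) : ℝ) with hx
  set y : ℕ → ℝ := fun b => ((η ((a : ℤ) + 1, (b : ℤ)) : ℤ) : ℝ) with hy
  have ha : (0 : ℝ) < (a : ℝ) + 1 := by positivity
  have ha2 : (0 : ℝ) < (a : ℝ) + 2 := by positivity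
  have e1 : Av a η - Av (a + 1) η = (1 / ((a : ℝ) + 1)) * ∑ b ∈ Finset.range (a + 1), (x b - y b) +
      (1 / (((a : ℝ) + 1) * (a + 2))) * ∑ b ∈ Finset.range (a + 1), ((b : ℝ) + 1) * (y b - y (b + 1)) := by
    have h2 : Av (a + 1) η = (1 / ((a : ℝ) + 2)) * (∑ b ∈ Finset.range (a + 1), y b + y (a + 1)) := by
      rw [← Finset.sum_range_succ]; unfold Av; push_cast; rw [show (a : ℝ) + 1 + 1 = a + 2 by ring]
    have h1 : Av a η = (1 / ((a : ℝ) + 1)) * ∑ b ∈ Finset.range (a + 1), x b := rfl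
    rw [h1, h2, abel_sum, Finset.sum_sub_distrib]
    push_cast
    field_simp
    ring
  have e2 : hA η a = ∑ b ∈ Finset.range (a + 1), (x b - y b) ^ 2 +
      ∑ b ∈ Finset.range (a + 1), (y b - y (b + 1)) ^ 2 := by
    unfold hA
    congr 1
    · refine Finset.sum_congr rfl fun b _ => ?_
      simp only [dd, nb, Bool.false_eq_true, if_false, hx, hy]; push_cast; ring
    · refine Finset.sum_congr rfl fun b _ => ?_
      simp only [dd, nb, if_true, hy]; push_cast; ring
  rw [e1, e2]
  set X := ∑ b ∈ Finset.range (a + 1), (x b - y b) with hX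
  set Y := ∑ b ∈ Finset.range (a + 1), ((b : ℝ) + 1) * (y b - y (b + 1)) with hY
  set hX2 := ∑ b ∈ Finset.range (a + 1), (x b - y b) ^ 2 with hhX
  set hY2 := ∑ b ∈ Finset.range (a + 1), (y b - y (b + 1)) ^ 2 with hhY
  have c1 : X ^ 2 ≤ ((a : ℝ) + 1) * hX2 := by
    have := sq_sum_le_card_mul_sum_sq (s := Finset.range (a + 1)) (f := fun b => x b - y b)
    simp only [Finset.card_range] at this; push_cast at this; exact this
  have c2 : Y ^ 2 ≤ (((a : ℝ) + 1) * ((a : ℝ) + 1) ^ 2) * hY2 := by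
    have := Finset.sum_mul_sq_le_sq_mul_sq (Finset.range (a + 1)) (fun b : ℕ => (b : ℝ) + 1) (fun b => y b - y (b + 1))
    refine this.trans ?_
    apply mul_le_mul_of_nonneg_right _ (Finset.sum_nonneg fun _ _ => sq_nonneg _)
    calc ∑ b ∈ Finset.range (a + 1), ((b : ℝ) + 1) ^ 2 ≤ ∑ b ∈ Finset.range (a + 1), ((a : ℝ) + 1) ^ 2 := by
          refine Finset.sum_le_sum fun b hb => ?_
          have : (b : ℝ) ≤ a := by exact_mod_cast Nat.lt_succ_iff.1 (Finset.mem_range.1 hb)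
          gcongr
      _ = _ := by simp
  have n1 : 0 ≤ hX2 := Finset.sum_nonneg fun _ _ => sq_nonneg _
  have n2 : 0 ≤ hY2 := Finset.sum_nonneg fun _ _ => sq_nonneg _
  have d1 : (1 / ((a : ℝ) + 1) * X) ^ 2 ≤ 1 / ((a : ℝ) + 1) * hX2 := by
    rw [mul_pow]
    calc _ ≤ (1 / ((a : ℝ) + 1)) ^ 2 * (((a : ℝ) + 1) * hX2) := by gcongr
      _ = _ := by field_simp
  have d2 : (1 / (((a : ℝ) + 1) * (a + 2)) * Y) ^ 2 ≤ 1 / ((a : ℝ) + 1) * hY2 := by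
    rw [mul_pow]
    calc _ ≤ (1 / (((a : ℝ) + 1) * (a + 2))) ^ 2 * ((((a : ℝ) + 1) * ((a : ℝ) + 1) ^ 2) * hY2) := by gcongr
      _ = (((a : ℝ) + 1) / (a + 2) ^ 2) * hY2 := by field_simp
      _ ≤ _ := by
        apply mul_le_mul_of_nonneg_right _ n2
        rw [div_le_div_iff₀ (by positivity) ha]
        nlinarith
  have e3 : 2 / ((a : ℝ) + 1) * (hX2 + hY2) = 2 * (1 / ((a : ℝ) + 1) * hX2) + 2 * (1 / ((a : ℝ) + 1) * hY2) := by
    ring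
  rw [e3]
  nlinarith [sq_nonneg ((1 / ((a : ℝ) + 1) * X) - (1 / (((a : ℝ) + 1) * (a + 2)) * Y))]

lemma hA_nonneg (η : Site → ℤ) (a : ℕ) : 0 ≤ hA η a :=
  add_nonneg (Finset.sum_nonneg fun _ _ => sq_nonneg _) (Finset.sum_nonneg fun _ _ => sq_nonneg _)

lemma En_nonneg (n : ℕ) : 0 ≤ En n := Finset.sum_nonneg fun _ _ => by positivity

lemma cs2 {x y E S ε h : ℝ} (hE : 0 ≤ E) (hS : 0 ≤ S) (hε : 0 ≤ ε) (hh : 0 ≤ h)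
    (h1 : x ^ 2 ≤ E * S) (h2 : y ^ 2 ≤ ε * h) : (x + y) ^ 2 ≤ (E + ε) * (S + h) := by
  have h3 : (x * y) ^ 2 ≤ (E * S) * (ε * h) := by
    rw [mul_pow]; exact mul_le_mul h1 h2 (sq_nonneg _) (by positivity)
  have h4 : 2 * (x * y) ≤ E * h + ε * S := by
    apply amgm (by positivity) (by positivity)
    calc (2 * (x * y)) ^ 2 = 4 * (x * y) ^ 2 := by ring
      _ ≤ 4 * ((E * S) * (ε * h)) := by linarith
      _ = _ := by ring
  calc (x + y) ^ 2 = x ^ 2 + y ^ 2 + 2 * (x * y) := by ring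
    _ ≤ E * S + ε * h + (E * h + ε * S) := by linarith
    _ = _ := by ring

lemma flow_aux (η : Site → ℤ) (n : ℕ) :
    (((η (0, 0) : ℤ) : ℝ) - Av n η) ^ 2 ≤ En n * ∑ a ∈ Finset.range n, hA η a := by
  induction n with
  | zero => simp [Av, En]
  | succ n ih =>
    have h1 := Av_step η n
    have e : En (n + 1) = En n + 2 / ((n : ℝ) + 1) := Finset.sum_range_succ _ _
    rw [e, Finset.sum_range_succ]
    set S := ∑ a ∈ Finset.range n, hA η a
    have hS : 0 ≤ S := Finset.sum_nonneg fun a _ => hA_nonneg η a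
    have hh := hA_nonneg η n
    have hE := En_nonneg n
    have : ((η (0, 0) : ℤ) : ℝ) - Av (n + 1) η = (((η (0, 0) : ℤ) : ℝ) - Av n η) + (Av n η - Av (n + 1) η) := by ring
    rw [this]
    exact cs2 hE hS (by positivity) hh ih h1

lemma flow {Λ : Finset Site} {η : Site → ℤ} (hη : Om Λ η) (n : ℕ) :
    (((η (0, 0) : ℤ) : ℝ) - Av n η) ^ 2 ≤ En n * HH η := by
  refine (flow_aux η n).trans (mul_le_mul_of_nonneg_left ?_ (En_nonneg n))
  set U := (Finset.range n).sigma (fun a => Finset.range (a + 1)) with hU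
  let i : (Σ _ : ℕ, ℕ) ↪ Edge := ⟨fun q => (((q.1 : ℤ), (q.2 : ℤ)), false), by
    rintro ⟨a, b⟩ ⟨a', b'⟩ h; simp at h; simp [h]⟩
  let j : (Σ _ : ℕ, ℕ) ↪ Edge := ⟨fun q => (((q.1 : ℤ) + 1, (q.2 : ℤ)), true), by
    rintro ⟨a, b⟩ ⟨a', b'⟩ h; simp at h; simp [h]⟩
  have hd : Disjoint (U.map i) (U.map j) := by
    rw [Finset.disjoint_left]
    intro e h1 h2
    obtain ⟨q, _, rfl⟩ := Finset.mem_map.1 h1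
    obtain ⟨q', _, h⟩ := Finset.mem_map.1 h2
    exact Bool.noConfusion (congrArg Prod.snd h : true = false)
  have := sum_le_HH hη.fs (U.map i ∪ U.map j)
  rw [Finset.sum_union hd, Finset.sum_map, Finset.sum_map, hU, Finset.sum_sigma, Finset.sum_sigma,
    ← Finset.sum_add_distrib] at this
  exact this

lemma abs_le_sq_int (m : ℤ) : -(m : ℝ) ≤ (m : ℝ) ^ 2 := by
  have : -m ≤ m ^ 2 := by
    rcases le_or_gt 0 m with h | h
    · nlinarith
    · nlinarith
  exact_mod_cast this

lemma seg_energy {Λ : Finset Site} {η : Site → ℤ} (hη : Om Λ η) (n m : ℕ) :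
    ∑ b ∈ Finset.range m, ((η ((n : ℤ), (b : ℤ)) : ℤ) : ℝ) ≤ HH η := by
  obtain ⟨M, hM⟩ := bdd Λ
  let i : ℕ × ℕ ↪ Edge := ⟨fun q => (((n : ℤ) + (q.2 : ℤ), (q.1 : ℤ)), false), by
    rintro ⟨a, b⟩ ⟨a', b'⟩ h; simp at h; simp [h]⟩
  have h1 := sum_le_HH hη.fs ((Finset.range m ×ˢ Finset.range M).map i)
  rw [Finset.sum_map, Finset.sum_product] at h1
  refine le_trans (Finset.sum_le_sum fun b _ => ?_) h1
  have h2 : ∀ J : ℕ, ((η ((n : ℤ), (b : ℤ)) : ℤ) : ℝ) = ((η ((n : ℤ) + J, (b : ℤ)) : ℤ) : ℝ) +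
      ∑ j ∈ Finset.range J, -((dd η (((n : ℤ) + j, (b : ℤ)), false) : ℤ) : ℝ) := by
    intro J
    induction J with
    | zero => simp
    | succ J ih =>
      rw [Finset.sum_range_succ, ih]
      simp only [dd, nb, Bool.false_eq_true, if_false]; push_cast; rw [← add_assoc]; ring
  rw [h2 M, hη ((n : ℤ) + M, (b : ℤ))]
  · simp only [Int.cast_zero, zero_add]
    exact Finset.sum_le_sum fun j _ => abs_le_sq_int _
  · intro hm
    have := (hM _ hm).1
    simp only at this
    rw [abs_of_nonneg (by positivity)] at this
    omega

lemma En_le {h : ℕ} (hh : 2 ≤ h) : En h ≤ 5 * Real.log h := by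
  have h1 : En h = 2 * (harmonic h : ℝ) := by
    unfold En harmonic
    push_cast
    rw [Finset.mul_sum]
    refine Finset.sum_congr rfl fun a _ => ?_
    rw [div_eq_mul_inv]
  have h2 := harmonic_le_one_add_log h
  have h3 : Real.log 2 ≤ Real.log h := Real.log_le_log (by norm_num) (by exact_mod_cast hh)
  have h4 := Real.log_two_gt_d9
  rw [h1]; linarith

def l1 (n : ℕ) (s : ℝ) : (Site → ℤ) →+ ℝ :=
  AddMonoidHom.mk' (fun η => s * (((η (0, 0) : ℤ) : ℝ) - Av n η)) (by
    intro a b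
    simp only [Av, Pi.add_apply, Int.cast_add, Finset.sum_add_distrib]; ring)

lemma one_point {Λ : Finset Site} (hΛ : Nice Λ) {β : ℝ} (hβ : 2 * b1 ≤ β) (hβ' : 60 ≤ β) {h : ℕ}
    (hh : 2 ≤ h) : WE β Λ (fun η => η (0, 0) = (h : ℤ)) ≤
      ENNReal.ofReal (Real.exp (-(β * h ^ 2 / Real.log h / 40))) * WE β Λ (fun _ => True) := by
  have hb := one_le_b1
  have hlog2 := Real.log_two_gt_d9
  have hlog : Real.log 2 ≤ Real.log h := Real.log_le_log (by norm_num) (by exact_mod_cast hh)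
  have hlp : 0 < Real.log h := by linarith
  have hh2 : (2 : ℝ) ≤ h := by exact_mod_cast hh
  set X := β * h ^ 2 / Real.log h with hX
  set t := β * h / (20 * Real.log h) with ht
  have htpos : 0 < t := by positivity
  have hth : t * h = X / 20 := by rw [ht, hX]; field_simp
  have hXh : β * h ≤ X := by
    rw [hX, le_div_iff₀ hlp]
    have : Real.log h ≤ h := (Real.log_le_sub_one_of_pos (by linarith)).trans (by linarith)
    nlinarith [mul_le_mul_of_nonneg_left this (show 0 ≤ β * h by positivity)]
  set Z := WE β Λ (fun _ => True) with hZ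
  -- Gaussian part
  have hg : ZL β Λ (l1 h (2 * t)) ≤ ENNReal.ofReal (Real.exp (X / 40)) * Z := by
    have hEn := En_le hh
    have := gauss hΛ hβ (l1 h (2 * t)) (E := (2 * t) ^ 2 * (5 * Real.log h)) (by positivity) (by
      intro η hη
      change (2 * t * (((η (0, 0) : ℤ) : ℝ) - Av h η)) ^ 2 ≤ _
      rw [mul_pow, mul_assoc]
      apply mul_le_mul_of_nonneg_left _ (by positivity)
      refine (flow hη h).trans ?_
      exact mul_le_mul_of_nonneg_right hEn (HH_nonneg _))
    rw [ZL_zero] at this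
    convert this using 4
    rw [hX, ht]; field_simp; norm_num
  -- average part
  set N : Finset Site := (Finset.range (h + 1)).image (fun b : ℕ => ((h : ℤ), (b : ℤ))) with hN
  have hNc : (N.card : ℝ) ≤ h + 1 := by
    have := Finset.card_image_le (s := Finset.range (h + 1)) (f := fun b : ℕ => ((h : ℤ), (b : ℤ)))
    rw [Finset.card_range] at this
    exact_mod_cast this
  have hav : ∑' η, ENNReal.ofReal (Real.exp (2 * t * Av h η)) * Wt β Λ η ≤
      ENNReal.ofReal (Real.exp (h + 1)) * Z := by
    have := Pp hΛ (β := β) N (fun η => ENNReal.ofReal (Real.exp (2 * t * Av h η))) (by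
      intro η η' hη
      have : Av h η = Av h η' := by
        unfold Av
        congr 1
        refine Finset.sum_congr rfl fun b hb => ?_
        rw [hη _ (Finset.mem_image_of_mem _ hb)]
      simp only [this]) 1 (by
      intro u hu
      rw [← ENNReal.ofReal_mul (by positivity), ← Real.exp_add, ← ENNReal.ofReal_one]
      apply ENNReal.ofReal_le_ofReal
      rw [← Real.exp_zero]
      apply Real.exp_le_exp.2
      have h1 := seg_energy hu h (h + 1)
      have h2 : Av h u ≤ (1 / ((h : ℝ) + 1)) * HH u := mul_le_mul_of_nonneg_left h1 (by positivity)
      have h3 : 2 * t * (1 / ((h : ℝ) + 1)) ≤ β / 2 := by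
        rw [ht, mul_one_div, div_le_iff₀ (by positivity)]
        rw [← mul_div_assoc, div_le_iff₀ (by positivity)]
        nlinarith [mul_pos (show (0:ℝ) < β by linarith) (show (0:ℝ) < h by linarith)]
      have h4 := HH_nonneg u
      have h5 : 2 * t * Av h u ≤ 2 * t * ((1 / ((h : ℝ) + 1)) * HH u) :=
        mul_le_mul_of_nonneg_left h2 (by positivity)
      have h6 : 2 * t * ((1 / ((h : ℝ) + 1)) * HH u) ≤ β / 2 * HH u := by
        rw [← mul_assoc]; exact mul_le_mul_of_nonneg_right h3 h4
      nlinarith)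
    refine this.trans ?_
    rw [one_mul]
    apply mul_le_mul' _ (WE_mono fun _ _ => trivial)
    exact ENNReal.ofReal_le_ofReal (Real.exp_le_exp.2 hNc)
  -- Markov
  have hm : 2 * (ENNReal.ofReal (Real.exp (X / 20)) * WE β Λ (fun η => η (0, 0) = (h : ℤ))) ≤
      2 * (ENNReal.ofReal (Real.exp (X / 40)) * Z) := by
    calc _ ≤ ZL β Λ (l1 h (2 * t)) + ∑' η, ENNReal.ofReal (Real.exp (2 * t * Av h η)) * Wt β Λ η := by
          unfold ZL WE
          rw [← ENNReal.tsum_mul_left, ← ENNReal.tsum_mul_left, ← ENNReal.tsum_add]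
          refine ENNReal.tsum_le_tsum fun η => ?_
          by_cases hη : η (0, 0) = (h : ℤ)
          swap
          · rw [if_neg hη]; simp
          rw [if_pos hη, ← mul_assoc, ← add_mul]
          gcongr
          rw [← ENNReal.ofReal_add (by positivity) (by positivity), ← ENNReal.ofReal_ofNat, ← ENNReal.ofReal_mul (by norm_num)]
          apply ENNReal.ofReal_le_ofReal
          change _ ≤ Real.exp (2 * t * (((η (0, 0) : ℤ) : ℝ) - Av h η)) + _
          rw [hη, ← hth, Int.cast_natCast]
          set p := t * (h - Av h η)
          set q := t * Av h η
          rw [show 2 * t * ((h : ℝ) - Av h η) = p + p by ring, show 2 * t * Av h η = q + q by ring,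
            show t * (h : ℝ) = p + q by ring, Real.exp_add, Real.exp_add, Real.exp_add]
          nlinarith [sq_nonneg (Real.exp p - Real.exp q)]
      _ ≤ ENNReal.ofReal (Real.exp (X / 40)) * Z + ENNReal.ofReal (Real.exp (X / 40)) * Z := by
          refine add_le_add hg (hav.trans ?_)
          gcongr
          nlinarith
      _ = _ := by rw [two_mul]
  have hm2 := (ENNReal.mul_le_mul_iff_right (by norm_num) (by norm_num)).1 hm
  have e1 : WE β Λ (fun η => η (0, 0) = (h : ℤ)) = ENNReal.ofReal (Real.exp (-(X / 20))) *
      (ENNReal.ofReal (Real.exp (X / 20)) * WE β Λ (fun η => η (0, 0) = (h : ℤ))) := by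
    rw [← mul_assoc, ← ENNReal.ofReal_mul (by positivity), ← Real.exp_add]; simp
  rw [e1]
  calc _ ≤ ENNReal.ofReal (Real.exp (-(X / 20))) * (ENNReal.ofReal (Real.exp (X / 40)) * Z) := by gcongr
    _ = _ := by
      rw [← mul_assoc, ← ENNReal.ofReal_mul (by positivity), ← Real.exp_add]
      congr 3; ring

lemma row2 {Λ : Finset Site} {χ : Site → ℤ} (hχ : Om Λ χ) {a b : ℤ} (h : χ (a, b) ≠ 0) :
    ∃ p q : ℤ, p < q ∧ dd χ ((p, b), false) ≠ 0 ∧ dd χ ((q, b), false) ≠ 0 := by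
  obtain ⟨M, hM⟩ := bdd Λ
  obtain ⟨q, -, hq⟩ := jump_h hχ h
  obtain ⟨j, h1, h2⟩ := first_jump (f := fun j : ℕ => χ (a - j, b)) (by simpa using h)
    ⟨M + a.natAbs, by
      apply hχ; intro hm
      have := (hM _ hm).1
      push_cast at this
      rw [abs_lt] at this
      rcases abs_cases a with h | h <;> omega⟩
  refine ⟨a - (j + 1), a + q, by omega, ?_, hq⟩
  intro hc; apply h2
  simp only [dd, nb] at hc
  push_cast
  have e : a - ((j : ℤ) + 1) + 1 = a - j := by ring
  rw [if_neg (by simp), e] at hc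
  linarith

lemma col2 {Λ : Finset Site} {χ : Site → ℤ} (hχ : Om Λ χ) {a b : ℤ} (h : χ (a, b) ≠ 0) :
    ∃ p q : ℤ, p < q ∧ dd χ ((a, p), true) ≠ 0 ∧ dd χ ((a, q), true) ≠ 0 := by
  obtain ⟨M, hM⟩ := bdd Λ
  obtain ⟨q, hq⟩ := jump_v hχ h
  obtain ⟨j, h1, h2⟩ := first_jump (f := fun j : ℕ => χ (a, b - j)) (by simpa using h)
    ⟨M + b.natAbs, by
      apply hχ; intro hm
      have := (hM _ hm).2
      push_cast at this
      rw [abs_lt] at this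
      rcases abs_cases b with h | h <;> omega⟩
  refine ⟨b - (j + 1), b + q, by omega, ?_, hq⟩
  intro hc; apply h2
  simp only [dd, nb] at hc
  push_cast
  have e : b - ((j : ℤ) + 1) + 1 = b - j := by ring
  rw [if_pos (by simp), e] at hc
  linarith

lemma card_le_HH {η : Site → ℤ} (h : FS η) (T : Finset Edge) (hT : ∀ e ∈ T, dd η e ≠ 0) :
    (T.card : ℝ) ≤ HH η := by
  refine le_trans ?_ (sum_le_HH h T)
  rw [Finset.card_eq_sum_ones]; push_cast
  exact Finset.sum_le_sum fun e he => one_le_sq_int (hT e he)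

lemma six {Λ : Finset Site} {χ : Site → ℤ} (hχ : Om Λ χ) {z : Site} (hz : z ≠ (0, 0))
    (h0 : χ (0, 0) ≠ 0) (h1 : χ z ≠ 0) : 6 ≤ HH χ := by
  obtain ⟨a, b⟩ := z
  by_cases ha : a = 0
  · subst ha
    have hb : b ≠ 0 := fun h => hz (by rw [h])
    obtain ⟨p, q, pq, hp, hq⟩ := row2 hχ h0
    obtain ⟨r, s, rs, hr, hs⟩ := row2 hχ h1
    obtain ⟨t, u, tu, ht, hu⟩ := col2 hχ h0
    have := card_le_HH hχ.fs {((p, 0), false), ((q, 0), false), ((r, b), false), ((s, b), false),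
      ((0, t), true), ((0, u), true)} (by simp [hp, hq, hr, hs, ht, hu])
    rw [Finset.card_insert_of_notMem, Finset.card_insert_of_notMem, Finset.card_insert_of_notMem,
      Finset.card_insert_of_notMem, Finset.card_insert_of_notMem, Finset.card_singleton] at this
    · norm_num at this; exact this
    all_goals simp; try omega
  · obtain ⟨p, q, pq, hp, hq⟩ := col2 hχ h0
    obtain ⟨r, s, rs, hr, hs⟩ := col2 hχ h1
    obtain ⟨t, u, tu, ht, hu⟩ := row2 hχ h0
    have := card_le_HH hχ.fs {((0, p), true), ((0, q), true), ((a, r), true), ((a, s), true),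
      ((t, 0), false), ((u, 0), false)} (by simp [hp, hq, hr, hs, ht, hu])
    rw [Finset.card_insert_of_notMem, Finset.card_insert_of_notMem, Finset.card_insert_of_notMem,
      Finset.card_insert_of_notMem, Finset.card_insert_of_notMem, Finset.card_singleton] at this
    · norm_num at this; exact this
    all_goals simp; try omega

lemma Pp_ev {Λ : Finset Site} (hΛ : Nice Λ) {β : ℝ} (N : Finset Site) (A : (Site → ℤ) → Prop)
    (hA : ∀ η η' : Site → ℤ, (∀ x ∈ N, η x = η' x) → (A η ↔ A η')) (κ : ENNReal)
    (hκ : ∀ u, Om Λ u → A u → ENNReal.ofReal (Real.exp (-(β - b1) * HH u)) ≤ κ) :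
    WE β Λ A ≤ κ * ENNReal.ofReal (Real.exp N.card) * WE β Λ (fun η => ∀ x ∈ N, η x = 0) := by
  have := Pp hΛ (β := β) N (fun η => if A η then 1 else 0)
    (by intro η η' h; simp only [hA η η' h]) κ
    (by
      intro u hu
      by_cases h : A u
      · simpa [h] using hκ u hu h
      · simp [h])
  refine le_trans (le_of_eq ?_) this
  unfold WE; congr 1; ext η; split_ifs <;> simp

lemma WT_le1 {Λ : Finset Site} (hΛ : Nice Λ) {β : ℝ} (hβ : b1 ≤ β) (x : Site) :
    WE β Λ (fun _ => True) ≤ ENNReal.ofReal (Real.exp 1) * WE β Λ (fun η => η x = 0) := by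
  have := Pp_ev hΛ (β := β) {x} (fun _ => True) (by simp) 1
    (by intro u hu _; rw [← ENNReal.ofReal_one]; apply ENNReal.ofReal_le_ofReal
        rw [Real.exp_le_one_iff]; nlinarith [HH_nonneg u])
  simpa using this

lemma WT_le2 {Λ : Finset Site} (hΛ : Nice Λ) {β : ℝ} (hβ : b1 ≤ β) {x z : Site} (hz : z ≠ x) :
    WE β Λ (fun _ => True) ≤ ENNReal.ofReal (Real.exp 2) * WE β Λ (fun η => η x = 0 ∧ η z = 0) := by
  have := Pp_ev hΛ (β := β) {x, z} (fun _ => True) (by simp) 1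
    (by intro u hu _; rw [← ENNReal.ofReal_one]; apply ENNReal.ofReal_le_ofReal
        rw [Real.exp_le_one_iff]; nlinarith [HH_nonneg u])
  rw [Finset.card_pair hz.symm] at this
  simpa using this

lemma W11 {Λ : Finset Site} (hΛ : Nice Λ) {β : ℝ} (hβ : b1 ≤ β) {z : Site} (hz : z ≠ (0, 0)) :
    WE β Λ (fun η => η (0, 0) = 1 ∧ η z = 1) ≤
      ENNReal.ofReal (Real.exp (-6 * (β - b1) + 2)) * WE β Λ (fun η => η (0, 0) = 0 ∧ η z = 0) := by
  have := Pp_ev hΛ (β := β) {(0, 0), z} (fun η => η (0, 0) = 1 ∧ η z = 1)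
    (by intro η η' h; rw [h (0,0) (by simp), h z (by simp)]) (ENNReal.ofReal (Real.exp (-6 * (β - b1))))
    (by intro u hu ⟨h1, h2⟩; apply ENNReal.ofReal_le_ofReal
        have := six hu hz (by rw [h1]; simp) (by rw [h2]; simp)
        rw [Real.exp_le_exp]; nlinarith [HH_nonneg u])
  rw [Finset.card_pair hz.symm, ← ENNReal.ofReal_mul (by positivity), ← Real.exp_add] at this
  simpa using this

def dl (x : Site) (k : ℤ) : Site → ℤ := fun y => if y = x then k else 0

def Sx (x : Site) (η : Site → ℤ) : ℤ :=
  4 * η x - η (x.1 + 1, x.2) - η (x.1 - 1, x.2) - η (x.1, x.2 + 1) - η (x.1, x.2 - 1)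

lemma Om_dl {Λ : Finset Site} {x : Site} (hx : x ∈ Λ) (k : ℤ) : Om Λ (dl x k) := by
  intro y hy; unfold dl; rw [if_neg]; rintro rfl; exact hy hx

lemma dd_dl (x : Site) (k : ℤ) (e : Edge) (h1 : e ≠ (x, true)) (h2 : e ≠ (x, false))
    (h3 : e ≠ ((x.1, x.2 - 1), true)) (h4 : e ≠ ((x.1 - 1, x.2), false)) : dd (dl x k) e = 0 := by
  obtain ⟨⟨a, b⟩, s⟩ := e
  obtain ⟨c, d⟩ := x
  cases s
  · simp only [dd, nb, dl, ne_eq, Prod.mk.injEq, and_true, Bool.false_eq_true, if_false, and_false, not_false_eq_true] at *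
    rw [if_neg (by omega), if_neg (by omega)]; rfl
  · simp only [dd, nb, dl, ne_eq, Prod.mk.injEq, and_true, Bool.true_eq_false, if_true, and_false, not_false_eq_true] at *
    rw [if_neg (by omega), if_neg (by omega)]; rfl

lemma HH_dl {Λ : Finset Site} {η : Site → ℤ} (hη : Om Λ η) {x : Site} (hx : x ∈ Λ) (k : ℤ) :
    HH (η + dl x k) = HH η + (4 * (k : ℝ) ^ 2 + 2 * k * Sx x η) := by
  have hs := (hη.fs.add (Om_dl hx k).fs).summable
  have : HH (η + dl x k) - HH η = (4 * (k : ℝ) ^ 2 + 2 * k * Sx x η) := by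
    unfold HH
    rw [← hs.tsum_sub hη.fs.summable]
    rw [tsum_eq_sum (s := {(x, true), (x, false), ((x.1, x.2 - 1), true), ((x.1 - 1, x.2), false)})]
    · obtain ⟨c, d⟩ := x
      rw [Finset.sum_insert, Finset.sum_insert, Finset.sum_insert, Finset.sum_singleton]
      · simp [dd, nb, dl, Sx]; ring
      all_goals simp
      all_goals omega
    · intro e he
      simp only [Finset.mem_insert, Finset.mem_singleton, not_or] at he
      have := dd_dl x k e he.1 he.2.1 he.2.2.1 he.2.2.2
      rw [dd_add, this]; simp
  linarith

lemma shift_le {β : ℝ} {Λ : Finset Site} {x : Site} (hx : x ∈ Λ) (k : ℤ) (c : ℝ)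
    {A B : (Site → ℤ) → Prop}
    (h : ∀ η, A η → B (η + dl x k) ∧ c ≤ -β * (4 * (k : ℝ) ^ 2 + 2 * k * Sx x η)) :
    ENNReal.ofReal (Real.exp c) * WE β Λ A ≤ WE β Λ B := by
  unfold WE
  rw [← (Equiv.addRight (dl x k)).tsum_eq (fun η => if B η then Wt β Λ η else 0), ← ENNReal.tsum_mul_left]
  apply ENNReal.tsum_le_tsum
  intro η
  by_cases hA : A η
  swap
  · rw [if_neg hA]; simp
  obtain ⟨hB, hc⟩ := h η hA
  have hB' : B (Equiv.addRight (dl x k) η) := hB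
  rw [if_pos hA, if_pos hB']
  change _ ≤ Wt β Λ (η + dl x k)
  rw [Wt, Wt, ← ENNReal.ofReal_mul (by positivity)]
  apply ENNReal.ofReal_le_ofReal
  unfold wR
  by_cases ho : Om Λ η
  · rw [if_pos ho, if_pos (ho.add (Om_dl hx k)), ← Real.exp_add, Real.exp_le_exp, HH_dl ho hx]
    linarith
  · rw [if_neg ho, mul_zero]; split_ifs <;> positivity

lemma WE_or {β : ℝ} {Λ : Finset Site} {A B C : (Site → ℤ) → Prop} (h : ∀ η, A η → B η ∨ C η) :
    WE β Λ A ≤ WE β Λ B + WE β Λ C := by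
  unfold WE; rw [← ENNReal.tsum_add]
  apply ENNReal.tsum_le_tsum
  intro η
  by_cases hA : A η
  · rcases h η hA with h' | h'
    · simp [hA, h']
    · simp [hA, h']
  · simp [hA]

lemma WE_neg (β : ℝ) (Λ : Finset Site) (A : (Site → ℤ) → Prop) :
    WE β Λ (fun η => A (-η)) = WE β Λ A := by
  unfold WE
  rw [← (Equiv.neg (Site → ℤ)).tsum_eq (fun η => if A η then Wt β Λ η else 0)]
  congr 1; ext η
  have : Wt β Λ (-η) = Wt β Λ η := by
    unfold Wt wR
    have : Om Λ (-η) ↔ Om Λ η := by unfold Om; simp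
    simp only [this, HH_neg]
  simp [this]

lemma dl_self (x : Site) (k : ℤ) (η : Site → ℤ) : (η + dl x k) x = η x + k := by simp [dl]
lemma dl_ne {x z : Site} (h : z ≠ x) (k : ℤ) (η : Site → ℤ) : (η + dl x k) z = η z := by
  simp [dl, h]

lemma W10 {β : ℝ} (hβ : 0 ≤ β) {Λ : Finset Site} {x z : Site} (hx : x ∈ Λ) (hz : z ≠ x) :
    ENNReal.ofReal (Real.exp (-(4 * β))) * WE β Λ (fun η => η x = 0 ∧ η z = 0) ≤
      2 * WE β Λ (fun η => η x = 1 ∧ η z = 0) := by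
  have h1 : ENNReal.ofReal (Real.exp (-(4 * β))) * WE β Λ (fun η => (η x = 0 ∧ η z = 0) ∧ Sx x η ≤ 0) ≤
      WE β Λ (fun η => η x = 1 ∧ η z = 0) := by
    apply shift_le hx 1
    rintro η ⟨⟨a, b⟩, c⟩
    refine ⟨⟨by rw [dl_self, a]; rfl, by rw [dl_ne hz, b]⟩, ?_⟩
    have : ((Sx x η : ℤ) : ℝ) ≤ 0 := by exact_mod_cast c
    push_cast; nlinarith
  have h2 : ENNReal.ofReal (Real.exp (-(4 * β))) * WE β Λ (fun η => (η x = 0 ∧ η z = 0) ∧ 0 ≤ Sx x η) ≤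
      WE β Λ (fun η => η x = 1 ∧ η z = 0) := by
    rw [← WE_neg β Λ (fun η => η x = 1 ∧ η z = 0)]
    apply shift_le hx (-1)
    rintro η ⟨⟨a, b⟩, c⟩
    refine ⟨⟨by rw [Pi.neg_apply, dl_self, a]; rfl, by rw [Pi.neg_apply, dl_ne hz, b]; rfl⟩, ?_⟩
    have : (0 : ℝ) ≤ ((Sx x η : ℤ) : ℝ) := by exact_mod_cast c
    push_cast; nlinarith
  rw [two_mul]
  refine le_trans ?_ (add_le_add h1 h2)
  rw [← mul_add]
  gcongr
  apply WE_or
  intro η h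
  rcases le_total (Sx x η) 0 with h' | h'
  · exact Or.inl ⟨h, h'⟩
  · exact Or.inr ⟨h, h'⟩

lemma half_aux {W V : ENNReal} (hfin : W ≠ ⊤) (hV : V ≠ ⊤)
    (h5 : W ≤ ENNReal.ofReal (1/2) * W + V) : W ≤ ENNReal.ofReal 2 * V := by
  lift W to NNReal using hfin
  lift V to NNReal using hV
  have e1 : ENNReal.ofReal (1/2) = ((1/2 : NNReal) : ENNReal) := by
    rw [ENNReal.ofReal, Real.toNNReal_div (by norm_num)]; simp
  have e2 : ENNReal.ofReal 2 = ((2 : NNReal) : ENNReal) := by simp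
  rw [e1] at h5
  rw [e2]
  norm_cast at h5 ⊢
  rw [← NNReal.coe_le_coe] at *
  push_cast at *
  linarith

lemma big {β : ℝ} (hβ : 0 ≤ β) {Λ : Finset Site} {p q : Site} (hq : q ∈ Λ) (hz : p ≠ q) (h : ℤ)
    (i : ℕ) (hfin : WE β Λ (fun η => η p = h ∧ η q = h) ≠ ⊤)
    (hs : WE β Λ (fun η => η p = h ∧ η q = h + 1) ≤
      ENNReal.ofReal (Real.exp (-(1 + 4 * β + 8 * β * i))) * WE β Λ (fun η => η p = h ∧ η q = h)) :
    WE β Λ (fun η => η p = h ∧ η q = h) ≤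
      ENNReal.ofReal (2 * Real.exp (-(4 * β * i ^ 2))) * WE β Λ (fun η => η p = h) := by
  have h1 : ENNReal.ofReal (Real.exp (-(4 * β + 8 * β * i))) *
      WE β Λ (fun η => (η p = h ∧ η q = h) ∧ Sx q η ≤ 4 * i) ≤
      WE β Λ (fun η => η p = h ∧ η q = h + 1) := by
    apply shift_le hq 1
    rintro η ⟨⟨a, b⟩, c⟩
    refine ⟨⟨by rw [dl_ne hz, a], by rw [dl_self, b]⟩, ?_⟩
    have : ((Sx q η : ℤ) : ℝ) ≤ 4 * i := by exact_mod_cast c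
    push_cast; nlinarith
  have h2 : ENNReal.ofReal (Real.exp (4 * β * i ^ 2)) *
      WE β Λ (fun η => (η p = h ∧ η q = h) ∧ 4 * i ≤ Sx q η) ≤ WE β Λ (fun η => η p = h) := by
    apply shift_le hq (-i)
    rintro η ⟨⟨a, b⟩, c⟩
    refine ⟨by rw [dl_ne hz, a], ?_⟩
    have : 4 * (i : ℝ) ≤ ((Sx q η : ℤ) : ℝ) := by exact_mod_cast c
    push_cast
    nlinarith [mul_nonneg (mul_nonneg hβ (Nat.cast_nonneg (α := ℝ) i)) (sub_nonneg.2 this)]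
  have h3 : WE β Λ (fun η => η p = h ∧ η q = h) ≤
      WE β Λ (fun η => (η p = h ∧ η q = h) ∧ Sx q η ≤ 4 * i) +
      WE β Λ (fun η => (η p = h ∧ η q = h) ∧ 4 * i ≤ Sx q η) := by
    apply WE_or
    intro η h
    rcases le_total (Sx q η) (4 * i) with h' | h'
    · exact Or.inl ⟨h, h'⟩
    · exact Or.inr ⟨h, h'⟩
  have inv : ∀ (c : ℝ) (a b : ENNReal), ENNReal.ofReal (Real.exp c) * a ≤ b →
      a ≤ ENNReal.ofReal (Real.exp (-c)) * b := by
    intro c a b hab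
    calc a = ENNReal.ofReal (Real.exp (-c)) * (ENNReal.ofReal (Real.exp c) * a) := by
          rw [← mul_assoc, ← ENNReal.ofReal_mul (by positivity), ← Real.exp_add]; simp
      _ ≤ _ := by gcongr
  set W := WE β Λ (fun η => η p = h ∧ η q = h)
  have h4 : WE β Λ (fun η => (η p = h ∧ η q = h) ∧ Sx q η ≤ 4 * i) ≤ ENNReal.ofReal (1/2) * W := by
    refine (inv _ _ _ (h1.trans hs)).trans ?_
    rw [← mul_assoc, ← ENNReal.ofReal_mul (by positivity), ← Real.exp_add]
    gcongr
    have : -(-(4 * β + 8 * β * i)) + -(1 + 4 * β + 8 * β * i) = (-1 : ℝ) := by ring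
    rw [this, Real.exp_neg, one_div]
    have := Real.add_one_le_exp (1 : ℝ)
    gcongr; linarith
  have h5 := h3.trans (add_le_add h4 (inv _ _ _ h2))
  set V := ENNReal.ofReal (Real.exp (-(4 * β * i ^ 2))) * WE β Λ (fun η => η p = h)
  rw [ENNReal.ofReal_mul (by norm_num), mul_assoc]
  change W ≤ ENNReal.ofReal 2 * V
  by_cases hV : V = ⊤
  · rw [hV]; simp
  clear_value W V
  exact half_aux hfin hV h5

lemma WE_sub {β : ℝ} {Λ Λ' : Finset Site} (h : Λ ⊆ Λ') (A : (Site → ℤ) → Prop) :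
    WE β Λ A ≤ WE β Λ' A := by
  apply ENNReal.tsum_le_tsum
  intro η
  by_cases hA : A η
  swap
  · rw [if_neg hA, if_neg hA]
  rw [if_pos hA, if_pos hA]
  apply ENNReal.ofReal_le_ofReal
  unfold wR
  by_cases h1 : Om Λ η
  · have h2 : Om Λ' η := fun x hx => h1 x (fun hh => hx (h hh))
    rw [if_pos h1, if_pos h2]
  · rw [if_neg h1]; split_ifs <;> positivity

lemma WE_insert {β : ℝ} {Λ : Finset Site} {y : Site} (hy : y ∉ Λ) (A : (Site → ℤ) → Prop) :
    WE β (insert y Λ) (fun η => A η ∧ η y = 0) = WE β Λ A := by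
  unfold WE; congr 1; ext η
  have : Om Λ η ↔ Om (insert y Λ) η ∧ η y = 0 := by
    constructor
    · intro h; exact ⟨fun x hx => h x (fun hh => hx (by simp [hh])), h y hy⟩
    · rintro ⟨h, h0⟩ x hx
      by_cases hxy : x = y
      · rw [hxy, h0]
      · exact h x (by simp [hxy, hx])
  unfold Wt wR
  by_cases hA : A η <;> by_cases h0 : η y = 0 <;> by_cases h1 : Om (insert y Λ) η <;> simp [*]

lemma R_mono {β : ℝ} (Λ s : Finset Site) (x : Site) (h : ℤ)
    (hf : WE β (Λ ∪ s) (fun _ => True) ≠ ⊤) :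
    WE β Λ (fun η => η x = h) * WE β (Λ ∪ s) (fun η => η x = 0) ≤
      WE β (Λ ∪ s) (fun η => η x = h) * WE β Λ (fun η => η x = 0) := by
  induction s using Finset.induction_on with
  | empty => simp
  | insert y s hy ih =>
    rw [Finset.union_insert] at *
    have hf' : WE β (Λ ∪ s) (fun _ => True) ≠ ⊤ :=
      ne_top_of_le_ne_top hf (WE_sub (Finset.subset_insert _ _) _)
    have ih := ih hf'
    by_cases hyy : y ∈ Λ ∪ s
    · rw [Finset.insert_eq_of_mem hyy]; exact ih
    have hp := W_pin β (insert y (Λ ∪ s)) x y h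
    rw [WE_insert hyy (fun η => η x = h), WE_insert hyy (fun η => η x = 0)] at hp
    set a := WE β Λ (fun η => η x = h)
    set b := WE β Λ (fun η => η x = 0)
    set c := WE β (Λ ∪ s) (fun η => η x = h)
    set d := WE β (Λ ∪ s) (fun η => η x = 0) with hd
    set e := WE β (insert y (Λ ∪ s)) (fun η => η x = h)
    set f := WE β (insert y (Λ ∪ s)) (fun η => η x = 0)
    have d0 : d ≠ 0 := WE_pos (Om_zero _) rfl
    have dt : d ≠ ⊤ := ne_top_of_le_ne_top hf' (WE_mono fun _ _ => trivial)
    have : d * (a * f) ≤ d * (e * b) := by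
      calc d * (a * f) = (a * d) * f := by ring
        _ ≤ (c * b) * f := by gcongr
        _ = (c * f) * b := by ring
        _ ≤ (e * d) * b := by gcongr
        _ = _ := by ring
    exact (ENNReal.mul_le_mul_iff_right d0 dt).1 this

def tr (z : Site) : Site ≃ Site := Equiv.addRight z

lemma HH_tr (z : Site) (η : Site → ℤ) : HH (η ∘ tr z) = HH η := by
  unfold HH
  rw [← ((tr z).prodCongr (Equiv.refl Bool)).tsum_eq (fun e : Edge => ((dd η e : ℤ) : ℝ) ^ 2)]
  congr 1; ext ⟨⟨a, b⟩, s⟩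
  obtain ⟨c, d⟩ := z
  cases s <;> simp [dd, nb, tr, add_right_comm]

lemma WE_tr (β : ℝ) (Λ Λ' : Finset Site) (z : Site) (hΛ : ∀ x, x ∈ Λ' ↔ x + z ∈ Λ) (h : ℤ) :
    WE β Λ (fun η => η z = h) = WE β Λ' (fun η => η (0, 0) = h) := by
  unfold WE
  symm
  refine (((tr z).symm.arrowCongr (Equiv.refl ℤ)).tsum_eq _).symm.trans ?_
  refine tsum_congr fun η => ?_
  have e : ((tr z).symm.arrowCongr (Equiv.refl ℤ)) η = η ∘ tr z := by ext x; simp [Equiv.arrowCongr]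
  rw [e]
  have e1 : (η ∘ tr z) (0, 0) = η z := by
    simp only [Function.comp, tr, Equiv.coe_addRight]; congr 1; simp
  have e2 : Om Λ' (η ∘ tr z) ↔ Om Λ η := by
    unfold Om
    constructor
    · intro hh x hx
      have := hh (x - z) (by rw [hΛ]; simpa using hx)
      simpa [tr] using this
    · intro hh x hx
      have := hh (x + z) (by rw [← hΛ]; exact hx)
      simpa [tr] using this
  have e3 : Wt β Λ' (η ∘ tr z) = Wt β Λ η := by
    unfold Wt wR
    simp only [e2, HH_tr]
  by_cases hh : η z = h
  · rw [if_pos (e1.trans hh), if_pos hh, e3]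
  · rw [if_neg (fun hc => hh (e1.symm.trans hc)), if_neg hh]

lemma mem_ball' (L : ℕ) (x : Site) : x ∈ ball L ↔ x.1 ^ 2 + x.2 ^ 2 ≤ (L : ℤ) ^ 2 := by
  unfold ball
  simp only [Int.ceil_natCast, Finset.mem_filter, Finset.mem_product, Finset.mem_Icc]
  constructor
  · rintro ⟨-, h⟩; exact_mod_cast h
  · intro h
    refine ⟨⟨abs_le.1 (abs_le_of_sq_le_sq (by nlinarith) (by positivity)),
      abs_le.1 (abs_le_of_sq_le_sq (by nlinarith) (by positivity))⟩, ?_⟩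
    exact_mod_cast h

lemma ball_mono {L L' : ℕ} (h : L ≤ L') : ball L ⊆ ball L' := by
  intro x hx
  rw [mem_ball'] at *
  refine hx.trans ?_
  gcongr

lemma ball_shift (L : ℕ) (z x : Site) (h : x + z ∈ ball L) :
    x ∈ ball ((L + (z.1.natAbs + z.2.natAbs) : ℕ) : ℝ) := by
  rw [mem_ball'] at *
  simp only [Prod.fst_add, Prod.snd_add] at h
  obtain ⟨a, b⟩ := x
  obtain ⟨c, d⟩ := z
  simp only at *
  push_cast
  have hc : c ^ 2 + d ^ 2 ≤ (|c| + |d|) ^ 2 := by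
    nlinarith [sq_abs c, sq_abs d, mul_nonneg (abs_nonneg c) (abs_nonneg d)]
  set m := |c| + |d|
  have hm : 0 ≤ m := by positivity
  have hL : (0 : ℤ) ≤ L := by positivity
  have cs : -((a + c) * c + (b + d) * d) ≤ L * m := by
    apply abs_le_of_sq_le_sq' _ (by positivity) |>.2
    have : ((a + c) * c + (b + d) * d) ^ 2 ≤ ((a + c) ^ 2 + (b + d) ^ 2) * (c ^ 2 + d ^ 2) := by
      nlinarith [sq_nonneg ((a + c) * d - (b + d) * c)]
    calc _ = ((a + c) * c + (b + d) * d) ^ 2 := by ring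
      _ ≤ _ := this
      _ ≤ (L : ℤ) ^ 2 * m ^ 2 := by gcongr
      _ = _ := by ring
  nlinarith

lemma ball_zero_mem (L : ℕ) : (0, 0) ∈ ball L := by rw [mem_ball']; simp

lemma far {β : ℝ} (hβ : b1 ≤ β) (h : ℤ) (z : Site) : ∃ L₀ : ℕ, ∀ L : ℕ, L₀ ≤ L →
    WE β (ball L) (fun η => η z = h) ≤
      ENNReal.ofReal (2 * Real.exp 1) * WE β (ball L) (fun η => η (0, 0) = h) := by
  have fin : ∀ (L : ℕ) A, WE β (ball L) A ≠ ⊤ := fun L A => WE_ne_top (nice_ball L) hβ A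
  have p0 : ∀ (L : ℕ), 0 < (WE β (ball L) (fun η => η (0,0) = 0)).toReal := fun L =>
    ENNReal.toReal_pos (WE_pos (Om_zero _) rfl) (fin _ _)
  have ph : ∀ (L : ℕ), 0 < (WE β (ball L) (fun η => η (0,0) = h)).toReal := fun L =>
    ENNReal.toReal_pos (WE_pos (Om_dl (ball_zero_mem L) h) (by simp [dl])) (fin _ _)
  set r : ℕ → ℝ := fun L => (WE β (ball L) (fun η => η (0,0) = h)).toReal /
    (WE β (ball L) (fun η => η (0,0) = 0)).toReal with hr
  have gen : ∀ (Λ : Finset Site) (L : ℕ), Λ ⊆ ball L →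
      (WE β Λ (fun η => η (0,0) = h)).toReal ≤ r L * (WE β Λ (fun η => η (0,0) = 0)).toReal := by
    intro Λ L hs
    have := R_mono (β := β) Λ (ball L) (0,0) h
    rw [Finset.union_eq_right.2 hs] at this
    have := this (fin _ _)
    have fin' : ∀ A, WE β Λ A ≠ ⊤ := fun A => ne_top_of_le_ne_top (fin L A) (WE_sub hs A)
    have := ENNReal.toReal_mono (ENNReal.mul_ne_top (fin _ _) (fin' _)) this
    rw [ENNReal.toReal_mul, ENNReal.toReal_mul] at this
    simp only [hr]
    rw [div_mul_eq_mul_div, le_div_iff₀ (p0 L)]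
    exact this
  have mono : Monotone r := by
    intro L L' hL
    rw [hr]; simp only
    rw [div_le_iff₀ (p0 L)]
    exact gen _ _ (ball_mono hL)
  have bd : ∀ L, r L ≤ Real.exp 1 := by
    intro L
    simp only [hr]
    rw [div_le_iff₀ (p0 L)]
    have := (WE_mono (A := fun η => η (0,0) = h) fun _ _ => trivial).trans (WT_le1 (nice_ball L) hβ (0,0))
    have := ENNReal.toReal_mono (ENNReal.mul_ne_top (by simp) (fin _ _)) this
    rwa [ENNReal.toReal_mul, ENNReal.toReal_ofReal (by positivity)] at this
  have bdd : BddAbove (Set.range r) := ⟨Real.exp 1, by rintro _ ⟨L, rfl⟩; exact bd L⟩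
  have rp : ∀ L, 0 < r L := fun L => div_pos (ph L) (p0 L)
  have sp : 0 < ⨆ L, r L := lt_of_lt_of_le (rp 0) (le_ciSup bdd 0)
  obtain ⟨L₀, hL₀⟩ := exists_lt_of_lt_ciSup (show (⨆ L, r L) / 2 < ⨆ L, r L by linarith)
  refine ⟨L₀, fun L hL => ?_⟩
  have h1 : ∀ k, r k ≤ 2 * r L := by
    intro k
    have := le_ciSup bdd k
    have := mono hL
    linarith
  set Λ' := (ball L).image (fun x => x - z) with hΛ'
  have hmem : ∀ x, x ∈ Λ' ↔ x + z ∈ ball L := by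
    intro x; rw [hΛ', Finset.mem_image]
    constructor
    · rintro ⟨y, hy, rfl⟩; simpa using hy
    · intro hx; exact ⟨x + z, hx, by simp⟩
  have h2 := gen Λ' (L + (z.1.natAbs + z.2.natAbs)) (fun x hx => ball_shift L z x ((hmem x).1 hx))
  rw [← WE_tr β (ball L) Λ' z hmem h, ← WE_tr β (ball L) Λ' z hmem 0] at h2
  have h3 := (WE_mono (A := fun η => η z = 0) fun _ _ => trivial).trans (WT_le1 (nice_ball L) hβ (0,0))
  have h3 := ENNReal.toReal_mono (ENNReal.mul_ne_top (by simp) (fin _ _)) h3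
  rw [ENNReal.toReal_mul, ENNReal.toReal_ofReal (by positivity)] at h3
  rw [← ENNReal.toReal_le_toReal (fin _ _) (ENNReal.mul_ne_top ENNReal.ofReal_ne_top (fin _ _)),
    ENNReal.toReal_mul, ENNReal.toReal_ofReal (by positivity)]
  have h4 : r L * (WE β (ball L) (fun η => η (0,0) = 0)).toReal =
    (WE β (ball L) (fun η => η (0,0) = h)).toReal := div_mul_cancel₀ _ (p0 L).ne'
  calc _ ≤ _ := h2
    _ ≤ (2 * r L) * (Real.exp 1 * (WE β (ball L) (fun η => η (0,0) = 0)).toReal) := by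
        gcongr
        · exact h1 _
    _ = 2 * Real.exp 1 * (r L * (WE β (ball L) (fun η => η (0,0) = 0)).toReal) := by ring
    _ = _ := by rw [h4]

lemma chain_small {w : ℤ → ℤ → ℝ} (pos : ∀ a b, 0 < w a b)
    (h1 : ∀ a b δ, δ ≤ 1 → w (a + δ) (b + 1) * w a (b - 1) ≤ w (a + δ) b * w a b) (n : ℕ) :
    w (n + 1) (n + 1) * w 1 0 ≤ w 1 1 * w (n + 1) n := by
  induction n with
  | zero => simp
  | succ n ih =>
    have := h1 (n + 1) (n + 1) 1 le_rfl
    push_cast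
    rw [show ((n : ℤ) + 1 - 1) = n by ring] at this
    have p := pos (n + 1) (n + 1)
    have p1 := pos (n + 1) n
    have p2 := pos (n + 1 + 1) (n + 1)
    have : w (n + 1) (n + 1) * w (n + 1) n * (w (n + 1 + 1) (n + 1 + 1) * w 1 0) ≤
        w (n + 1) (n + 1) * w (n + 1) n * (w 1 1 * w (n + 1 + 1) (n + 1)) := by
      calc _ = (w (n + 1 + 1) (n + 1 + 1) * w (n + 1) n) * (w (n + 1) (n + 1) * w 1 0) := by ring
        _ ≤ (w (n + 1 + 1) (n + 1) * w (n + 1) (n + 1)) * (w 1 1 * w (n + 1) n) :=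
          mul_le_mul this ih (mul_pos p (pos _ _)).le (mul_pos p2 p).le
        _ = _ := by ring
    exact le_of_mul_le_mul_left this (mul_pos p p1)

lemma chain_large {w : ℤ → ℤ → ℝ} (pos : ∀ a b, 0 < w a b)
    (h1 : ∀ a b δ, δ ≤ 1 → w (a + δ) (b + 1) * w a (b - 1) ≤ w (a + δ) b * w a b)
    (h2 : ∀ a b δ, δ ≤ 1 → w (b + 1) (a + δ) * w (b - 1) a ≤ w b (a + δ) * w b a) (h : ℕ) (hh : 1 ≤ h) :
    ((w h (h + 1) / w h h) * (w (h + 1) h / w h h)) ^ h * w 0 0 ≤ w h h := by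
  set t := (w h (h + 1) / w h h) * (w (h + 1) h / w h h) with ht
  have t0 : 0 < t := by have := pos h (h+1); have := pos h h; have := pos (h+1) h; positivity
  have A : ∀ k : ℤ, w (k + 1) (k + 1 + 1) * w k k ≤ w (k + 1) (k + 1) * w k (k + 1) := by
    intro k
    have := h1 k (k + 1) 1 le_rfl
    rwa [show k + 1 - 1 = k by ring] at this
  have B : ∀ k : ℤ, w (k + 1 + 1) (k + 1 + 1) * w k (k + 1) ≤ w (k + 1) (k + 1 + 1) * w (k + 1) (k + 1) := by
    intro k
    have := h2 (k + 1) (k + 1) 1 le_rfl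
    rwa [show k + 1 - 1 = k by ring] at this
  have C : ∀ k : ℤ, w (k + 1 + 1) (k + 1) * w k (k + 1) ≤ w (k + 1) (k + 1) * w (k + 1) (k + 1) := by
    intro k
    have := h2 (k + 1) (k + 1) 0 (by norm_num)
    rwa [show k + 1 - 1 = k by ring, add_zero] at this
  have D : ∀ k : ℤ, w (k + 1 + 1) (k + 1 + 1) / w (k + 1) (k + 1) ≤ w (k + 1) (k + 1) / w k k := by
    intro k
    have p1 := pos (k + 1) (k + 1)
    have p2 := pos k k
    have p3 := pos k (k + 1)
    have p4 := pos (k + 1) (k + 1 + 1)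
    rw [div_le_div_iff₀ p1 p2]
    have := mul_le_mul (A k) (B k) (mul_pos (pos _ _) (pos _ _)).le (mul_pos (pos _ _) (pos _ _)).le
    refine le_of_mul_le_mul_left (a := w k (k + 1) * w (k + 1) (k + 1 + 1)) ?_ (by positivity)
    linarith
  have E : ∀ j : ℕ, j + 1 ≤ h → t ≤ w (j + 1) (j + 1) / w j j := by
    intro j hj
    induction hk : h - (j + 1) generalizing j with
    | zero =>
      have : h = j + 1 := by omega
      have e : (h : ℤ) = j + 1 := by omega
      rw [ht, e]
      have p1 := pos (j + 1) (j + 1)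
      have p2 := pos j j
      have p3 := pos j (j + 1)
      rw [div_mul_div_comm, div_le_div_iff₀ (by positivity) p2]
      refine le_of_mul_le_mul_left (a := w j (j + 1)) ?_ (by positivity)
      have := mul_le_mul (A j) (C j) (mul_pos (pos _ _) (pos _ _)).le (mul_pos (pos _ _) (pos _ _)).le
      linarith
    | succ m ih =>
      refine (ih (j + 1) (by omega) (by omega)).trans ?_
      push_cast
      exact D j
  have F : ∀ j : ℕ, j ≤ h → t ^ j * w 0 0 ≤ w j j := by
    intro j hj
    induction j with
    | zero => simp
    | succ j ih =>
      have h3 := ih (by omega)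
      have h4 := E j hj
      rw [le_div_iff₀ (pos _ _)] at h4
      push_cast
      calc t ^ (j + 1) * w 0 0 = t * (t ^ j * w 0 0) := by ring
        _ ≤ t * w j j := by gcongr
        _ ≤ _ := h4
  exact F h le_rfl

lemma toR_le {a b : ENNReal} (ha : a ≠ ⊤) (hb : b ≠ ⊤) {c : ℝ} (hc : 0 ≤ c) :
    a.toReal ≤ c * b.toReal ↔ a ≤ ENNReal.ofReal c * b := by
  rw [← ENNReal.toReal_le_toReal ha (ENNReal.mul_ne_top ENNReal.ofReal_ne_top hb), ENNReal.toReal_mul,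
    ENNReal.toReal_ofReal hc]

lemma main_bound {β : ℝ} (hβ : 6 * b1 + 100 ≤ β) {h : ℕ} (hh : 2 ≤ h) {z : Site} (hz : z ≠ (0, 0))
    {Λ : Finset Site} (hΛ : Nice Λ) (m0 : (0, 0) ∈ Λ) (mz : z ∈ Λ)
    (hfar : WE β Λ (fun η => η z = h) ≤
      ENNReal.ofReal (2 * Real.exp 1) * WE β Λ (fun η => η (0, 0) = h)) :
    (WE β Λ (fun η => η (0, 0) = h ∧ η z = h)).toReal ≤
      Real.exp (-(1/4000000) * (h : ℝ) ^ 2 / Real.log h ^ 2) *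
        (WE β Λ (fun η => η (0, 0) = h)).toReal := by
  have hb1 := one_le_b1
  have hbb : b1 ≤ β := by linarith
  have hb0 : 0 ≤ β := by linarith
  have fin : ∀ A, WE β Λ A ≠ ⊤ := fun A => WE_ne_top hΛ hbb A
  set w : ℤ → ℤ → ℝ := fun a b => (WE β Λ (fun η => η (0, 0) = a ∧ η z = b)).toReal with hw
  set P := (WE β Λ (fun η => η (0, 0) = h)).toReal with hP
  have P0 : 0 ≤ P := ENNReal.toReal_nonneg
  have pos : ∀ a b, 0 < w a b := by
    intro a b
    refine ENNReal.toReal_pos (WE_pos ((Om_dl m0 a).add (Om_dl mz b)) ⟨?_, ?_⟩) (fin _)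
    · rw [dl_ne hz.symm]; simp [dl]
    · rw [dl_self]; simp [dl, hz]
  have h1 : ∀ a b δ, δ ≤ 1 → w (a + δ) (b + 1) * w a (b - 1) ≤ w (a + δ) b * w a b := by
    intro a b δ hδ
    have := ENNReal.toReal_mono (ENNReal.mul_ne_top (fin _) (fin _)) (W_lc hb0 Λ (0,0) z a b δ hδ)
    rwa [ENNReal.toReal_mul, ENNReal.toReal_mul] at this
  have sw : ∀ a b, WE β Λ (fun η => η z = a ∧ η (0, 0) = b) = WE β Λ (fun η => η (0, 0) = b ∧ η z = a) := by
    intro a b; congr 1; ext η; exact and_comm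
  have h2 : ∀ a b δ, δ ≤ 1 → w (b + 1) (a + δ) * w (b - 1) a ≤ w b (a + δ) * w b a := by
    intro a b δ hδ
    have := ENNReal.toReal_mono (ENNReal.mul_ne_top (fin _) (fin _)) (W_lc hb0 Λ z (0,0) a b δ hδ)
    rw [ENNReal.toReal_mul, ENNReal.toReal_mul, sw, sw, sw, sw] at this
    exact this
  have wP : ∀ b, w h b ≤ P := fun b => ENNReal.toReal_mono (fin _) (WE_mono fun _ h => h.1)
  change w h h ≤ _
  have hlog : 0 < Real.log h := Real.log_pos (by exact_mod_cast hh)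
  set x : ℝ := h / Real.log h with hx
  have xe : -(1/4000000) * (h : ℝ) ^ 2 / Real.log h ^ 2 = -(1/4000000) * x ^ 2 := by
    rw [hx]; field_simp
  have x0 : 0 ≤ x := by positivity
  rw [xe]
  have hP00 : P ≤ Real.exp (2 - β * h * x / 40) * w 0 0 := by
    have a1 := one_point hΛ (β := β) (by linarith) (by linarith) hh
    have a2 := WT_le2 hΛ hbb hz
    rw [← toR_le (fin _) (fin _) (by positivity)] at a1 a2
    calc P ≤ _ := a1
      _ ≤ Real.exp (-(β * h ^ 2 / Real.log h / 40)) * (Real.exp 2 * w 0 0) := by gcongr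
      _ = _ := by
        rw [← mul_assoc, ← Real.exp_add]
        congr 2; rw [hx]; ring
  have e1 := Real.add_one_le_exp (1 : ℝ)
  rcases lt_or_ge x 2000 with hx2 | hx2
  · obtain ⟨n, rfl⟩ : ∃ n, h = n + 1 := ⟨h - 1, by omega⟩
    have c1 := chain_small pos h1 n
    have c2 := W11 hΛ hbb hz
    have c3 := W10 hb0 m0 hz
    rw [← toR_le (fin _) (fin _) (by positivity)] at c2
    have c3 := ENNReal.toReal_mono (ENNReal.mul_ne_top (by simp) (fin _)) c3
    rw [ENNReal.toReal_mul, ENNReal.toReal_mul, ENNReal.toReal_ofReal (by positivity)] at c3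
    have c3 : Real.exp (-(4 * β)) * w 0 0 ≤ 2 * w 1 0 := by simpa using c3
    have c2 : w 1 1 ≤ Real.exp (-6 * (β - b1) + 2) * w 0 0 := c2
    have c4 : w 1 1 ≤ Real.exp (-1) * w 1 0 := by
      have : w 0 0 ≤ Real.exp (4 * β) * (2 * w 1 0) := by
        calc w 0 0 = Real.exp (4 * β) * (Real.exp (-(4 * β)) * w 0 0) := by
              rw [← mul_assoc, ← Real.exp_add]; simp
          _ ≤ _ := by gcongr
      calc w 1 1 ≤ _ := c2
        _ ≤ Real.exp (-6 * (β - b1) + 2) * (Real.exp (4 * β) * (Real.exp 1 * w 1 0)) := by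
          have := pos 1 0
          have e2 : (2 : ℝ) ≤ Real.exp 1 := by linarith
          refine mul_le_mul_of_nonneg_left (this.le |> fun _ => ?_) (by positivity)
          refine ‹w 0 0 ≤ _›.trans ?_
          gcongr
        _ = Real.exp (-6 * (β - b1) + 2 + 4 * β + 1) * w 1 0 := by
          rw [Real.exp_add _ (1 : ℝ), Real.exp_add _ (4 * β)]; ring
        _ ≤ _ := by
          have := pos 1 0
          gcongr; linarith
    have c5 : w (n + 1) (n + 1) ≤ Real.exp (-1) * w (n + 1) n := by
      refine le_of_mul_le_mul_right (a := w 1 0) ?_ (pos 1 0)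
      have := pos (n + 1) n
      calc _ ≤ _ := c1
        _ ≤ (Real.exp (-1) * w 1 0) * w (n + 1) n := by gcongr
        _ = _ := by ring
    push_cast at wP ⊢
    calc _ ≤ _ := c5
      _ ≤ Real.exp (-(1/4000000) * x ^ 2) * P := by
        have := wP n
        have := pos (n + 1) n
        gcongr
        nlinarith
  · set i : ℕ := ⌊(x - 480) / 640⌋₊ with hi
    have i1 : (i : ℝ) ≤ (x - 480) / 640 := Nat.floor_le (by linarith)
    have i2 : (x - 480) / 640 < i + 1 := Nat.lt_floor_add_one _
    have i3 : x / 2000 ≤ i := by linarith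
    have i4 : 1 ≤ (i : ℝ) := by linarith
    have cl := chain_large pos h1 h2 h (by omega)
    set s := 1 + 4 * β + 8 * β * i with hs
    set a := w h (h + 1) / w h h with ha
    set a' := w (h + 1) h / w h h with ha'
    have fin_case : ∀ Q : ℝ, 0 ≤ Q → Q ≤ (2 * Real.exp 1) * P →
        w h h ≤ 2 * Real.exp (-(4 * β * i ^ 2)) * Q → w h h ≤ Real.exp (-(1/4000000) * x ^ 2) * P := by
      intro Q hQ hQP hwQ
      refine hwQ.trans ?_
      calc 2 * Real.exp (-(4 * β * i ^ 2)) * Q ≤ Real.exp 1 * Real.exp (-(4 * β * i ^ 2)) * ((Real.exp 1 * Real.exp 1) * P) := by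
            refine mul_le_mul ?_ (hQP.trans ?_) hQ (by positivity)
            · gcongr; linarith
            · gcongr; linarith
        _ = Real.exp (1 + -(4 * β * i ^ 2) + (1 + 1)) * P := by
            rw [Real.exp_add, Real.exp_add, Real.exp_add]; ring
        _ ≤ _ := by
            gcongr
            have : (x / 2000) ^ 2 ≤ (i : ℝ) ^ 2 := by gcongr
            have : (1 : ℝ) ≤ (i : ℝ) ^ 2 := by nlinarith
            have : (100 : ℝ) * (i : ℝ) ^ 2 ≤ β * i ^ 2 := by gcongr; linarith
            nlinarith
    by_cases hA : a ≤ Real.exp (-s)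
    · rw [ha, div_le_iff₀ (pos _ _)] at hA
      have := big hb0 mz hz.symm h i (fin _) ((toR_le (fin _) (fin _) (by positivity)).1 hA)
      rw [← toR_le (fin _) (fin _) (by positivity)] at this
      exact fin_case P P0 (by nlinarith) this
    by_cases hA' : a' ≤ Real.exp (-s)
    · rw [ha', div_le_iff₀ (pos _ _)] at hA'
      have hA2 := (toR_le (fin _) (fin _) (by positivity)).1 hA'
      rw [← sw, ← sw] at hA2
      have := big hb0 m0 hz h i (fin _) hA2
      rw [← toR_le (fin _) (fin _) (by positivity), sw] at this
      refine fin_case _ ENNReal.toReal_nonneg ?_ this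
      exact (toR_le (fin _) (fin _) (by positivity)).2 hfar
    exfalso
    push Not at hA hA'
    have k1 : Real.exp (-s * 2 * h) < (a * a') ^ h := by
      have : Real.exp (-s * 2 * h) = (Real.exp (-s) * Real.exp (-s)) ^ h := by
        rw [← Real.exp_add, ← Real.exp_nat_mul]; congr 1; ring
      rw [this]
      apply pow_lt_pow_left₀ _ (by positivity) (by omega)
      exact mul_lt_mul'' hA hA' (by positivity) (by positivity)
    have k2 : (a * a') ^ h ≤ Real.exp (2 - β * h * x / 40) := by
      refine le_of_mul_le_mul_right (a := w 0 0) ?_ (pos 0 0)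
      exact cl.trans ((wP h).trans hP00)
    have k3 := Real.exp_lt_exp.1 (k1.trans_le k2)
    have hh' : (2 : ℝ) ≤ h := by exact_mod_cast hh
    have k4 : 12 + 16 * (i : ℝ) ≤ x / 40 := by linarith
    have k5 : β * (12 + 16 * (i : ℝ)) ≤ β * (x / 40) := by gcongr
    have k6 : 2 * s + 1 ≤ β * (x / 40) := by rw [hs]; linarith
    have k7 : (h : ℝ) * (2 * s + 1) ≤ h * (β * (x / 40)) := by gcongr
    nlinarith

theorem dg_two_point_large_deviation :
    ∃ β₀ > (0 : ℝ), ∃ c₂ > (0 : ℝ),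
      ∀ β ≥ β₀, ∀ h : ℕ, 2 ≤ h → ∀ z : Site, z ≠ (0, 0) → ∃ L₀ : ℕ, ∀ L : ℕ, L₀ ≤ L →
        dgProb β (ball L) (fun η => η z = (h : ℤ) ∧ η (0, 0) = (h : ℤ)) ≤
          Real.exp (-c₂ * (h : ℝ) ^ 2 / Real.log h ^ 2) *
            dgProb β (ball L) (fun η => η (0, 0) = (h : ℤ)) := by
  have hb1 := one_le_b1
  refine ⟨6 * b1 + 100, by linarith, 1/4000000, by norm_num, ?_⟩
  intro β hβ h hh z hz
  obtain ⟨L₀, hL₀⟩ := far (β := β) (by linarith) h z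
  refine ⟨L₀ + (z.1.natAbs + z.2.natAbs), fun L hL => ?_⟩
  have mz : z ∈ ball L := by
    have := ball_shift L₀ (-z) z (by rw [add_neg_cancel]; exact ball_zero_mem L₀)
    exact ball_mono (by simpa using hL) this
  have := main_bound hβ hh hz (nice_ball L) (ball_zero_mem L) mz (hL₀ L (by omega))
  unfold dgProb
  rw [dgW_eq, dgW_eq, dgW_eq, ← mul_div_assoc]
  refine div_le_div_of_nonneg_right ?_ ENNReal.toReal_nonneg
  refine le_trans (le_of_eq ?_) this
  congr 2; ext η; exact and_comm
end
end

section
/- Fix a real p > 2. There exists a constant c = c(p) > 0 such that for every integer h ≥ 1 and every collection γ₁, …, γ_h of nested contours each of whose interiors contains the origin (that is, 0 ∈ V_{γ_h} ⊆ V_{γ_{h−1}} ⊆ … ⊆ V_{γ₁}), one has ∑_e Δ_e^p ≥ c·h², where the sum runs over all edges e of the dual lattice and Δ_e = #{i ∈ {1,…,h} : e is an edge of γ_i}. -/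
open Filter Topology Classical

noncomputable section

/-- A contour: a simple closed circuit in the dual lattice `(ℤ²)* = ℤ² + (1/2,1/2)`,
recorded as a cyclic sequence of dual vertices (with the identification
`(a+1/2, b+1/2) ↔ (a,b)`), consecutive vertices adjacent, with all (unordered) edges
distinct. `n` is the number of edges `|γ|`. -/
structure Contour where
  n : ℕ
  npos : 0 < n
  v : ZMod n → Site
  adj : ∀ i, adjP (v i) (v (i + 1))
  edges_distinct : ∀ i j : ZMod n, s(v i, v (i + 1)) = s(v j, v (j + 1)) → i = j

/-- The dual edge with endpoints `u + (1/2,1/2)` and `w + (1/2,1/2)` crosses the primal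
nearest-neighbor pair `{x, y}` (for adjacent `u, w` and adjacent `x, y`, this says the two
unit segments have the same midpoint). -/
def crosses (u w x y : Site) : Prop := u + w + (1, 1) = x + y

/-- The interior `V_γ` of a contour: the sites `x` such that every nearest-neighbor path
from `x` to infinity crosses some edge of `γ`. -/
def Contour.interior (γ : Contour) : Set Site :=
  {x | ∀ q : ℕ → Site, q 0 = x → (∀ k, adjP (q k) (q (k + 1))) →
    (∀ R : ℕ, ∃ k, (R : ℤ) < |(q k).1| + |(q k).2|) →
    ∃ k, ∃ i : ZMod γ.n, crosses (γ.v i) (γ.v (i + 1)) (q k) (q (k + 1))}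

/-- `Δ_e` for the dual edge `e = {x, y}`: the number of contours in the collection `γ`
having `e` as one of their edges. -/
def edgeMultiplicity {h : ℕ} (γ : Fin h → Contour) (x y : Site) : ℕ :=
  (Finset.univ.filter fun i : Fin h =>
    ∃ j : ZMod (γ i).n, s((γ i).v j, (γ i).v (j + 1)) = s(x, y)).card



instance contourNeZero (γ : Contour) : NeZero γ.n := ⟨γ.npos.ne'⟩

lemma sum_box_bound (q : ℝ) (hq1 : 1 < q) (hq2 : q < 2) (R : ℕ) :
    ∑ k ∈ Finset.range (R + 1), ∑ x ∈ (Finset.box k : Finset (ℤ × ℤ)),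
      (((k : ℝ) + 1) ^ q)⁻¹ ≤ 8 / (2 - q) * ((R : ℝ) + 1) ^ (2 - q) := by
  have ha : 0 < 2 - q := by linarith
  have ha1 : 2 - q ≤ 1 := by linarith
  induction R with
  | zero =>
    simp
    rw [le_div_iff₀ ha]; linarith
  | succ R ih =>
    rw [Finset.sum_range_succ]
    have h1 : ∑ x ∈ (Finset.box (R+1) : Finset (ℤ × ℤ)), ((((R+1 : ℕ) : ℝ) + 1) ^ q)⁻¹
        ≤ 8 / (2 - q) * ((((R+1 : ℕ) : ℝ) + 1) ^ (2 - q) - ((R : ℝ) + 1) ^ (2 - q)) := by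
      rw [Finset.sum_const, Int.card_box (by omega)]
      set y : ℝ := ((R+1 : ℕ) : ℝ) + 1 with hy
      have hy0 : 0 < y := by positivity
      have hy1 : (R : ℝ) + 1 = y * (1 + (-(1 / y))) := by
        field_simp; rw [hy]; push_cast; ring
      have hR : 8 * ((R + 1 : ℕ) : ℝ) ≤ 8 * y := by rw [hy]; linarith
      have hyge : 1 ≤ y := by rw [hy]; push_cast; linarith [(Nat.cast_nonneg R : (0:ℝ) ≤ R)]
      have hinv : 1 / y ≤ 1 := by rw [div_le_one hy0]; exact hyge
      have hb := rpow_one_add_le_one_add_mul_self (s := -(1/y)) (by linarith) ha.le ha1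
      rw [hy1, Real.mul_rpow hy0.le (by linarith)]
      have hya : 0 < y ^ (2 - q) := by positivity
      have e1 : (y ^ q)⁻¹ * y = y ^ (2-q) * (1 / y) := by
        rw [← Real.rpow_neg hy0.le, show 2 - q = -q + 2 by ring, Real.rpow_add hy0]
        norm_num
        field_simp
      have hyq : 0 < (y ^ q)⁻¹ := by positivity
      rw [nsmul_eq_mul]
      push_cast at hR ⊢
      calc 8 * ((R:ℝ) + 1) * (y ^ q)⁻¹ ≤ 8 * y * (y ^ q)⁻¹ := by gcongr
        _ = 8 * (y ^ (2-q) * (1 / y)) := by rw [← e1]; ring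
        _ = 8 / (2 - q) * (y ^ (2 - q) - y ^ (2 - q) * (1 + (2 - q) * -(1 / y))) := by
          field_simp; ring
        _ ≤ _ := by gcongr
    calc _ ≤ _ := add_le_add ih h1
      _ = _ := by ring

lemma contour_step (γ : Contour) (i : ZMod γ.n) (m : ℕ) :
    |(γ.v (i + m)).1 - (γ.v i).1| ≤ m ∧ |(γ.v (i + m)).2 - (γ.v i).2| ≤ m := by
  induction m with
  | zero => simp
  | succ m ih =>
    have h := γ.adj (i + m)
    unfold adjP at h
    rw [add_assoc] at h
    push_cast
    grind

lemma contour_dist (γ : Contour) (i j : ZMod γ.n) :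
    |(γ.v j).1 - (γ.v i).1| < γ.n ∧ |(γ.v j).2 - (γ.v i).2| < γ.n := by
  have h := contour_step γ i (j - i).val
  rw [ZMod.natCast_zmod_val, add_sub_cancel] at h
  have := ZMod.val_lt (j - i)
  omega

lemma contour_near (γ : Contour) (h0 : ((0 : ℤ), (0 : ℤ)) ∈ γ.interior) (j : ZMod γ.n) :
    |(γ.v j).1| ≤ 2 * γ.n ∧ |(γ.v j).2| ≤ 2 * γ.n := by
  obtain ⟨k, i, hi⟩ := h0 (fun k => ((k : ℤ), 0)) (by simp)
    (by intro k; simp [adjP]) (by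
      intro R; refine ⟨R + 1, ?_⟩
      simp only []
      push_cast; rw [abs_of_nonneg (by positivity)]; simp)
  obtain ⟨k', i', hi'⟩ := h0 (fun k => (-(k : ℤ), 0)) (by simp)
    (by intro k; simp [adjP]) (by
      intro R; refine ⟨R + 1, ?_⟩
      simp only []
      push_cast; rw [abs_neg, abs_of_nonneg (by positivity)]; simp)
  have a1 := γ.adj i
  have a2 := γ.adj i'
  have d1 := contour_dist γ i i'
  have d2 := contour_dist γ i j
  unfold crosses at hi hi'
  unfold adjP at a1 a2
  simp only [Prod.ext_iff, Prod.fst_add, Prod.snd_add] at hi hi'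
  push_cast at hi hi'
  have b1 : (γ.v i).1 = k ∧ -1 ≤ (γ.v i).2 ∧ (γ.v i).2 ≤ 0 := by grind
  have b2 : (γ.v i').1 = -k' - 1 := by grind
  have := γ.npos
  simp only [abs_lt, abs_le] at *
  omega

lemma mult_count {h : ℕ} (γ : Fin h → Contour) (S : Finset (Site × Site))
    (w : Site × Site → ℝ) (hw : ∀ e, 0 ≤ w e) (I : Finset (Fin h))
    (hI : ∀ i ∈ I, ∀ j, ((γ i).v j, (γ i).v (j + 1)) ∈ S) :
    ∑ i ∈ I, ∑ j : ZMod (γ i).n, w ((γ i).v j, (γ i).v (j + 1)) ≤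
      ∑ e ∈ S, (edgeMultiplicity γ e.1 e.2 : ℝ) * w e := by
  have e1 : ∀ e : Site × Site, (edgeMultiplicity γ e.1 e.2 : ℝ) * w e =
      ∑ i : Fin h, if (∃ j : ZMod (γ i).n, s((γ i).v j, (γ i).v (j + 1)) = s(e.1, e.2))
        then w e else 0 := by
    intro e
    rw [← Finset.sum_filter, Finset.sum_const, nsmul_eq_mul]
    unfold edgeMultiplicity
    congr!
  simp_rw [e1]
  rw [Finset.sum_comm]
  refine le_trans (Finset.sum_le_sum (f := fun i => ∑ j : ZMod (γ i).n, w ((γ i).v j, (γ i).v (j + 1))) (g := fun i => ∑ e ∈ S, if (∃ j : ZMod (γ i).n, s((γ i).v j, (γ i).v (j + 1)) = s(e.1, e.2)) then w e else 0) ?_) (Finset.sum_le_sum_of_subset_of_nonneg (Finset.subset_univ I) ?_)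
  · intro i hi
    rw [← Finset.sum_filter]
    have inj : Set.InjOn (fun j : ZMod (γ i).n => ((γ i).v j, (γ i).v (j + 1)))
        (Finset.univ : Finset (ZMod (γ i).n)) := by
      intro a _ b _ hab
      simp only [Prod.mk.injEq] at hab
      exact (γ i).edges_distinct a b (by rw [hab.1, hab.2])
    rw [← Finset.sum_image (f := w) inj]
    apply Finset.sum_le_sum_of_subset_of_nonneg
    · intro e he
      simp only [Finset.mem_image, Finset.mem_univ, true_and] at he
      obtain ⟨j, rfl⟩ := he
      exact Finset.mem_filter.2 ⟨hI i hi j, j, rfl⟩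
    · intros; exact hw _
  · intro i _ _
    apply Finset.sum_nonneg
    intro e _
    split_ifs
    · exact hw e
    · exact le_rfl

lemma mult_summable {h : ℕ} (γ : Fin h → Contour) (p : ℝ) (hp : 2 < p) :
    Summable fun e : Site × Site => (edgeMultiplicity γ e.1 e.2 : ℝ) ^ p := by
  apply summable_of_hasFiniteSupport
  have : (⋃ i : Fin h, ⋃ j : ZMod (γ i).n,
    ({((γ i).v j, (γ i).v (j + 1)), ((γ i).v (j + 1), (γ i).v j)} : Set (Site × Site))).Finite :=
    Set.finite_iUnion fun i => Set.finite_iUnion fun j => Set.toFinite _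
  refine this.subset ?_
  intro e he
  simp only [Function.mem_support] at he
  have : edgeMultiplicity γ e.1 e.2 ≠ 0 := by
    intro h0
    apply he
    rw [h0, Nat.cast_zero, Real.zero_rpow (by linarith)]
  obtain ⟨i, hi⟩ := Finset.card_ne_zero.1 this
  obtain ⟨j, hj⟩ := ((@Finset.mem_filter _ _ (_) _ _).1 hi).2
  simp only [Set.mem_iUnion]
  refine ⟨i, j, ?_⟩
  rw [Sym2.eq_iff] at hj
  rcases hj with ⟨a, b⟩ | ⟨a, b⟩
  · left; ext1 <;> simp [a, b]
  · right; ext1 <;> simp [a, b]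

lemma long_case {h : ℕ} (γ : Fin h → Contour) (p : ℝ) (hp : 2 < p) (I : Finset (Fin h))
    (hI : ∀ i ∈ I, h ≤ (γ i).n) :
    (I.card : ℝ) * h ≤ ∑' e : Site × Site, (edgeMultiplicity γ e.1 e.2 : ℝ) ^ p := by
  set S : Finset (Site × Site) := Finset.univ.biUnion fun i : Fin h =>
    Finset.univ.image fun j : ZMod (γ i).n => ((γ i).v j, (γ i).v (j + 1)) with hS
  have h1 := mult_count γ S (fun _ => 1) (fun _ => zero_le_one) I (by
    intro i _ j
    simp only [hS, Finset.mem_biUnion, Finset.mem_image, Finset.mem_univ, true_and]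
    exact ⟨i, j, rfl⟩)
  have h2 := (mult_summable γ p hp).sum_le_tsum S (fun e _ => by positivity)
  refine le_trans ?_ (le_trans (le_trans h1 ?_) h2)
  · rw [← nsmul_eq_mul]
    apply Finset.card_nsmul_le_sum
    intro i hi
    simp [ZMod.card]
    exact hI i hi
  · apply Finset.sum_le_sum
    intro e _
    rw [mul_one]
    rcases Nat.eq_zero_or_pos (edgeMultiplicity γ e.1 e.2) with h0 | h0
    · rw [h0]; simp; positivity
    · have : (1:ℝ) ≤ edgeMultiplicity γ e.1 e.2 := by exact_mod_cast h0
      exact Real.self_le_rpow_of_one_le this (by linarith)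

def supN (x : Site) : ℕ := max x.1.natAbs x.2.natAbs

def dirs : Finset Site := {(1, 0), (-1, 0), (0, 1), (0, -1)}

def bigS (R : ℕ) : Finset (Site × Site) :=
  (((Finset.range (R + 1)).biUnion fun k => (Finset.box k : Finset (ℤ × ℤ))) ×ˢ dirs).image
    fun z => (z.1, z.1 + z.2)

lemma mem_bigS (R : ℕ) (x y : Site) (hx : supN x ≤ R) (hxy : adjP x y) : (x, y) ∈ bigS R := by
  unfold bigS
  rw [Finset.mem_image]
  refine ⟨(x, y - x), ?_, by simp⟩
  rw [Finset.mem_product]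
  constructor
  · simp only [Finset.mem_biUnion, Finset.mem_range]
    exact ⟨supN x, by omega, Int.mem_box.2 rfl⟩
  · unfold adjP at hxy
    simp only [dirs, Finset.mem_insert, Finset.mem_singleton, Prod.ext_iff, Prod.fst_sub,
      Prod.snd_sub]
    grind

lemma sum_bigS (q : ℝ) (hq1 : 1 < q) (hq2 : q < 2) (R : ℕ) :
    ∑ e ∈ bigS R, (((supN e.1 : ℝ) + 1) ^ q)⁻¹ ≤
      32 / (2 - q) * ((R : ℝ) + 1) ^ (2 - q) := by
  unfold bigS
  rw [Finset.sum_image (by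
    intro a _ b _ hab
    simp only [Prod.mk.injEq] at hab
    obtain ⟨h1, h2⟩ := hab
    rw [h1] at h2
    exact Prod.ext h1 (add_left_cancel h2))]
  rw [Finset.sum_product]
  simp only [Finset.sum_const]
  have hc : dirs.card = 4 := by decide
  rw [hc, Finset.sum_nsmul, Finset.sum_biUnion]
  · have := sum_box_bound q hq1 hq2 R
    have e : ∑ k ∈ Finset.range (R + 1), ∑ x ∈ (Finset.box k : Finset (ℤ × ℤ)),
      (((supN x : ℝ) + 1) ^ q)⁻¹ = ∑ k ∈ Finset.range (R + 1), ∑ x ∈ (Finset.box k : Finset (ℤ × ℤ)),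
      (((k : ℝ) + 1) ^ q)⁻¹ := by
      apply Finset.sum_congr rfl
      intro k _
      apply Finset.sum_congr rfl
      intro x hx
      rw [show supN x = k from Int.mem_box.1 hx]
    rw [e, nsmul_eq_mul]
    push_cast
    calc _ ≤ 4 * _ := mul_le_mul_of_nonneg_left this (by norm_num)
      _ = _ := by ring
  · intro a _ b _ hab
    rw [Function.onFun, Finset.disjoint_left]
    intro x hx hx'
    exact hab ((Int.mem_box.1 hx).symm.trans (Int.mem_box.1 hx'))

lemma young' (p q : ℝ) (hpq : p.HolderConjugate q) (a b : ℝ) (ha : 0 ≤ a) (hb : 0 ≤ b) :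
    p * (a * b) - (p - 1) * b ^ q ≤ a ^ p := by
  have h := Real.young_inequality_of_nonneg ha hb hpq
  have hp := hpq.pos
  have hq := hpq.symm.pos
  have e : p / q = p - 1 := by
    have := hpq.sub_one_mul_conj
    field_simp; linarith
  have : p * (a * b) ≤ p * (a ^ p / p + b ^ q / q) := by gcongr
  have e2 : p * (a ^ p / p + b ^ q / q) = a ^ p + (p / q) * b ^ q := by field_simp
  rw [e2, e] at this
  linarith

lemma short_case (p q : ℝ) (hp : 2 < p) (hpq : p.HolderConjugate q) (hq1 : 1 < q) (hq2 : q < 2)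
    (s : ℝ) (hs : 0 < s)
    {h : ℕ} (hh : 1 ≤ h) (γ : Fin h → Contour)
    (h0 : ∀ i, ((0 : ℤ), (0 : ℤ)) ∈ (γ i).interior) (I : Finset (Fin h))
    (hI : ∀ i ∈ I, (γ i).n ≤ h) (hc : (h : ℝ) / 2 ≤ I.card) :
    (p * s / 6 - (p - 1) * (96 / (2 - q)) * s ^ q) * (h : ℝ) ^ 2 ≤
      ∑' e : Site × Site, (edgeMultiplicity γ e.1 e.2 : ℝ) ^ p := by
  have hh0 : (0 : ℝ) < h := by exact_mod_cast hh
  have hsup : ∀ i j, supN ((γ i).v j) ≤ 2 * (γ i).n := by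
    intro i j
    have := contour_near (γ i) (h0 i) j
    simp only [abs_le] at this
    unfold supN
    omega
  set S := bigS (2 * h) with hS
  have h1 := mult_count γ S (fun e => ((supN e.1 : ℝ) + 1)⁻¹) (fun _ => by positivity) I (by
    intro i hi j
    refine mem_bigS _ _ _ ((hsup i j).trans ?_) ((γ i).adj j)
    have := hI i hi
    omega)
  have h2 : (h : ℝ) / 6 ≤ ∑ i ∈ I, ∑ j : ZMod (γ i).n, ((supN ((γ i).v j) : ℝ) + 1)⁻¹ := by
    have : I.card • (1 / 3 : ℝ) ≤ ∑ i ∈ I, ∑ j : ZMod (γ i).n, ((supN ((γ i).v j) : ℝ) + 1)⁻¹ := by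
      apply Finset.card_nsmul_le_sum
      intro i _
      have hn : (0 : ℝ) < (γ i).n := by exact_mod_cast (γ i).npos
      have hn1 : (1 : ℝ) ≤ (γ i).n := by exact_mod_cast (γ i).npos
      have := Finset.card_nsmul_le_sum (Finset.univ : Finset (ZMod (γ i).n))
        (fun j => ((supN ((γ i).v j) : ℝ) + 1)⁻¹) ((3 * (γ i).n : ℝ)⁻¹) (by
          intro j _
          apply inv_anti₀ (by positivity)
          have : (supN ((γ i).v j) : ℝ) ≤ 2 * (γ i).n := by exact_mod_cast hsup i j
          linarith)
      refine le_trans (le_of_eq ?_) this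
      rw [Finset.card_univ, ZMod.card, nsmul_eq_mul]
      field_simp
    rw [nsmul_eq_mul] at this
    linarith
  have h3 := sum_bigS q hq1 hq2 (2 * h)
  have h4 : (((2 * h : ℕ) : ℝ) + 1) ^ (2 - q) ≤ 3 * (h : ℝ) ^ (2 - q) := by
    have : ((2 * h : ℕ) : ℝ) + 1 ≤ 3 * h := by
      push_cast
      have : (1 : ℝ) ≤ h := by exact_mod_cast hh
      linarith
    calc _ ≤ (3 * (h : ℝ)) ^ (2 - q) := by
            apply Real.rpow_le_rpow (by positivity) this (by linarith)
      _ = 3 ^ (2 - q) * (h : ℝ) ^ (2 - q) := Real.mul_rpow (by norm_num) hh0.le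
      _ ≤ _ := by
        gcongr
        calc (3 : ℝ) ^ (2 - q) ≤ 3 ^ (1 : ℝ) :=
              Real.rpow_le_rpow_of_exponent_le (by norm_num) (by linarith)
          _ = 3 := by norm_num
  have h5 : ∑ e ∈ S, (((supN e.1 : ℝ) + 1) ^ q)⁻¹ ≤ 96 / (2 - q) * (h : ℝ) ^ (2 - q) := by
    refine h3.trans ?_
    have : 0 ≤ 32 / (2 - q) := div_nonneg (by norm_num) (by linarith)
    calc _ ≤ 32 / (2 - q) * (3 * (h : ℝ) ^ (2 - q)) := mul_le_mul_of_nonneg_left h4 this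
      _ = _ := by ring
  have h6 := (mult_summable γ p hp).sum_le_tsum S (fun e _ => by positivity)
  refine le_trans ?_ h6
  have h7 : ∑ e ∈ S, (p * ((edgeMultiplicity γ e.1 e.2 : ℝ) * (s * h * ((supN e.1 : ℝ) + 1)⁻¹))
      - (p - 1) * (s * h * ((supN e.1 : ℝ) + 1)⁻¹) ^ q) ≤
      ∑ e ∈ S, (edgeMultiplicity γ e.1 e.2 : ℝ) ^ p :=
    Finset.sum_le_sum fun e _ => young' p q hpq _ _ (by positivity) (by positivity)
  refine le_trans ?_ h7
  rw [Finset.sum_sub_distrib]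
  have e1 : ∑ e ∈ S, (p * ((edgeMultiplicity γ e.1 e.2 : ℝ) * (s * h * ((supN e.1 : ℝ) + 1)⁻¹)))
      = p * s * h * ∑ e ∈ S, (edgeMultiplicity γ e.1 e.2 : ℝ) * ((supN e.1 : ℝ) + 1)⁻¹ := by
    rw [Finset.mul_sum]
    exact Finset.sum_congr rfl fun e _ => by ring
  have e2 : ∑ e ∈ S, (p - 1) * (s * h * ((supN e.1 : ℝ) + 1)⁻¹) ^ q
      = (p - 1) * s ^ q * (h : ℝ) ^ q * ∑ e ∈ S, (((supN e.1 : ℝ) + 1) ^ q)⁻¹ := by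
    rw [Finset.mul_sum]
    refine Finset.sum_congr rfl fun e _ => ?_
    rw [Real.mul_rpow (by positivity) (by positivity), Real.mul_rpow hs.le hh0.le,
      Real.inv_rpow (by positivity)]
    ring
  rw [e1, e2]
  have b1 : p * s * h * (h / 6) ≤ p * s * h *
      ∑ e ∈ S, (edgeMultiplicity γ e.1 e.2 : ℝ) * ((supN e.1 : ℝ) + 1)⁻¹ :=
    mul_le_mul_of_nonneg_left (h2.trans h1) (by positivity)
  have hp1 : 0 < p - 1 := by linarith
  have b2 : (p - 1) * s ^ q * (h : ℝ) ^ q * ∑ e ∈ S, (((supN e.1 : ℝ) + 1) ^ q)⁻¹ ≤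
      (p - 1) * s ^ q * (h : ℝ) ^ q * (96 / (2 - q) * (h : ℝ) ^ (2 - q)) :=
    mul_le_mul_of_nonneg_left h5 (by positivity)
  have e3 : (h : ℝ) ^ q * (h : ℝ) ^ (2 - q) = (h : ℝ) ^ 2 := by
    rw [← Real.rpow_add hh0]; norm_num
  have e4 : (p - 1) * s ^ q * (h : ℝ) ^ q * (96 / (2 - q) * (h : ℝ) ^ (2 - q)) =
    (p - 1) * s ^ q * (96 / (2 - q)) * (h : ℝ) ^ 2 := by rw [← e3]; ring
  rw [e4] at b2
  linarith

/-- **Claim 4.5.** For `p > 2` there is `c = c(p) > 0` such that for any `h` nested contours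
`γ₁, …, γ_h` whose interiors all contain the origin, `∑_e Δ_e^p ≥ c h²` (the sum over all
dual edges; each unordered edge is counted once, whence the factor 1/2 over ordered pairs). -/
theorem nested_contours_energy_lower_bound (p : ℝ) (hp : 2 < p) :
    ∃ c > (0 : ℝ), ∀ h : ℕ, 1 ≤ h → ∀ γ : Fin h → Contour,
      (∀ i, ((0 : ℤ), (0 : ℤ)) ∈ (γ i).interior) →
      (∀ i j : Fin h, i ≤ j → (γ j).interior ⊆ (γ i).interior) →
      c * (h : ℝ) ^ 2 ≤
        (1 / 2) * ∑' e : Site × Site, (edgeMultiplicity γ e.1 e.2 : ℝ) ^ p := by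
  have hpq : p.HolderConjugate (Real.conjExponent p) :=
    Real.HolderConjugate.conjExponent (by linarith)
  obtain ⟨q, hqd⟩ : ∃ q, q = Real.conjExponent p := ⟨_, rfl⟩
  rw [← hqd] at hpq
  have hq1 : 1 < q := hpq.symm.lt
  have hq2 : q < 2 := by
    rw [hqd, Real.conjExponent, div_lt_iff₀ (by linarith)]; linarith
  have hp1 : 0 < p - 1 := by linarith
  have hq3 : 0 < 2 - q := by linarith
  obtain ⟨K, hK⟩ : ∃ K, K = (p - 1) * (96 / (2 - q)) := ⟨_, rfl⟩
  have hK0 : 0 < K := by rw [hK]; positivity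
  obtain ⟨s, hs, hsK⟩ : ∃ s : ℝ, 0 < s ∧ K * s ^ q = p / 12 * s := by
    refine ⟨(p / 12 / K) ^ (1 / (q - 1)), by positivity, ?_⟩
    have hb : 0 < p / 12 / K := by positivity
    have hs : 0 < (p / 12 / K) ^ (1 / (q - 1)) := by positivity
    have : ((p / 12 / K) ^ (1 / (q - 1))) ^ (q - 1) = p / 12 / K := by
      rw [← Real.rpow_mul hb.le, one_div_mul_cancel (by linarith), Real.rpow_one]
    have e : ((p / 12 / K) ^ (1 / (q - 1))) ^ q = ((p / 12 / K) ^ (1 / (q - 1))) ^ (q - 1)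
        * (p / 12 / K) ^ (1 / (q - 1)) := by
      rw [Real.rpow_sub_one hs.ne']; field_simp
    rw [e, this]; field_simp
  refine ⟨min (1 / 4) (p * s / 24), by positivity, ?_⟩
  intro h hh γ h0 _
  have hh0 : (0 : ℝ) < h := by exact_mod_cast hh
  have hcard := Finset.card_filter_add_card_filter_not (s := (Finset.univ : Finset (Fin h)))
    (fun i => (γ i).n ≤ h)
  rw [Finset.card_univ, Fintype.card_fin] at hcard
  have hcard' : ((Finset.univ.filter fun i : Fin h => (γ i).n ≤ h).card : ℝ) +
    ((Finset.univ.filter fun i : Fin h => ¬ (γ i).n ≤ h).card : ℝ) = h := by exact_mod_cast hcard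
  by_cases hc : (h : ℝ) / 2 ≤ (Finset.univ.filter fun i : Fin h => (γ i).n ≤ h).card
  · have := short_case p q hp hpq hq1 hq2 s hs hh γ h0 _ (fun i hi => (Finset.mem_filter.1 hi).2) hc
    rw [← hK, hsK] at this
    calc _ ≤ p * s / 24 * (h : ℝ) ^ 2 := by gcongr; exact min_le_right _ _
      _ ≤ _ := by linarith
  · have := long_case γ p hp (Finset.univ.filter fun i : Fin h => ¬ (γ i).n ≤ h)
      (fun i hi => (not_le.1 (Finset.mem_filter.1 hi).2).le)
    calc _ ≤ 1 / 4 * (h : ℝ) ^ 2 := by gcongr; exact min_le_left _ _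
      _ ≤ 1 / 2 * (((Finset.univ.filter fun i : Fin h => ¬ (γ i).n ≤ h).card : ℝ) * h) := by
        nlinarith
      _ ≤ _ := by linarith
end
end
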